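/- arXiv:2003.00339 — 4 statements merged into one kernel-verified Lean document; each statement's English description precedes it below -/
import Mathlib

section
/- If A is a bounded operator on a Hilbert space H and M, N are (possibly unbounded) normal operators on H such that AN ⊆ MA (i.e., MA extends AN as unbounded operators), then AN* ⊆ M*A. -/
open LinearPMap

/-- Composition of partial linear maps: `T.pcomp S` is "first `S`, then `T`", with
domain `{x ∈ dom S : S x ∈ dom T}`. -/
noncomputable def LinearPMap.pcomp {H : Type*} [NormedAddCommGroup H] [InnerProductSpace ℂ H]
    (T S : H →ₗ.[ℂ] H) : H →ₗ.[ℂ] H where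
  domain := (Submodule.comap S.toFun T.domain).map S.domain.subtype
  toFun := T.toFun ∘ₗ (S.toFun.restrict fun _ hx => hx) ∘ₗ
    (Submodule.equivMapOfInjective S.domain.subtype S.domain.injective_subtype
      (Submodule.comap S.toFun T.domain)).symm.toLinearMap

/-- A densely defined closed operator `N` on a complex Hilbert space is normal if
`N* N = N N*` (as partial linear maps). -/
noncomputable def LinearPMap.IsNormalOp {H : Type*} [NormedAddCommGroup H]
    [InnerProductSpace ℂ H] [CompleteSpace H] (N : H →ₗ.[ℂ] H) : Prop :=
  Dense (N.domain : Set H) ∧ N.IsClosed ∧ N.adjoint.pcomp N = N.pcomp N.adjoint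

/-- A bounded everywhere-defined operator viewed as a partial linear map. -/
noncomputable def ContinuousLinearMap.toPMapTop {H : Type*} [NormedAddCommGroup H]
    [InnerProductSpace ℂ H] (A : H →L[ℂ] H) : H →ₗ.[ℂ] H :=
  (A : H →ₗ[ℂ] H).toPMap ⊤

variable {H : Type*} [NormedAddCommGroup H] [InnerProductSpace ℂ H] [CompleteSpace H]

theorem fpaux_mem_graph_pcomp (T S : H →ₗ.[ℂ] H) (x z : H) :
    (x, z) ∈ (T.pcomp S).graph ↔ ∃ y, (x, y) ∈ S.graph ∧ (y, z) ∈ T.graph := by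
  have key : ∀ (x : S.domain) (hx : S.toFun x ∈ T.domain) (hx' : (x : H) ∈ (T.pcomp S).domain),
      (T.pcomp S) ⟨x, hx'⟩ = T ⟨S.toFun x, hx⟩ := by
    intro x hx hx'
    have e : (Submodule.equivMapOfInjective S.domain.subtype S.domain.injective_subtype
      (Submodule.comap S.toFun T.domain)).symm ⟨x, hx'⟩ = ⟨x, hx⟩ := by
      rw [LinearEquiv.symm_apply_eq]
      rfl
    change T.toFun ((S.toFun.restrict fun _ hx => hx)
      ((Submodule.equivMapOfInjective S.domain.subtype S.domain.injective_subtype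
      (Submodule.comap S.toFun T.domain)).symm ⟨x, hx'⟩)) = _
    rw [e]
    rfl
  constructor
  · intro h
    rw [LinearPMap.mem_graph_iff] at h
    obtain ⟨⟨y, hy⟩, h1, h2⟩ := h
    simp only at h1 h2
    subst h1
    obtain ⟨w, hw, rfl⟩ := hy
    refine ⟨S w, S.mem_graph w, ?_⟩
    rw [← h2]
    have := key w hw ⟨w, hw, rfl⟩
    rw [show (T.pcomp S) ⟨S.domain.subtype w, ⟨w, hw, rfl⟩⟩ = T ⟨S.toFun w, hw⟩ from this]
    exact T.mem_graph ⟨S.toFun w, hw⟩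
  · rintro ⟨y, h1, h2⟩
    rw [LinearPMap.mem_graph_iff] at h1 h2
    obtain ⟨a, ha, ha'⟩ := h1
    obtain ⟨b, hb, hb'⟩ := h2
    simp only at ha ha' hb hb'
    subst ha
    have hm : S.toFun a ∈ T.domain := by
      have : S.toFun a = (b : H) := by rw [hb, ← ha']; rfl
      rw [this]; exact b.2
    rw [LinearPMap.mem_graph_iff]
    have hx' : (a : H) ∈ (T.pcomp S).domain := ⟨a, hm, rfl⟩
    refine ⟨⟨a, hx'⟩, rfl, ?_⟩
    rw [key a hm, ← hb']
    congr 1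
    apply Subtype.ext
    change S.toFun a = _
    rw [hb, ← ha']
    rfl

theorem fpaux_mem_graph_top (A : H →L[ℂ] H) (x y : H) :
    (x, y) ∈ A.toPMapTop.graph ↔ A x = y := by
  rw [LinearPMap.mem_graph_iff]
  constructor
  · rintro ⟨a, ha, hb⟩
    simp only at ha hb
    subst ha
    exact hb
  · rintro rfl
    exact ⟨⟨x, trivial⟩, rfl, rfl⟩

theorem fpaux_mem_adj {N : H →ₗ.[ℂ] H} (hd : Dense (N.domain : Set H)) (y w : H) :
    (y, w) ∈ N.adjoint.graph ↔ ∀ a b, (a, b) ∈ N.graph → inner ℂ b y = inner ℂ a w := by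
  rw [LinearPMap.adjoint_graph_eq_graph_adjoint hd, Submodule.mem_adjoint_iff]
  simp only [sub_eq_zero]

/-- The bounded data attached to a closed densely defined operator. -/
theorem fpaux_resolvent {N : H →ₗ.[ℂ] H} (hd : Dense (N.domain : Set H)) (hc : N.IsClosed) :
    ∃ B C : H →L[ℂ] H, (∀ h, (B h, C h) ∈ N.graph) ∧ (∀ h, (C h, h - B h) ∈ N.adjoint.graph) := by
  let e := WithLp.prodContinuousLinearEquiv 2 ℂ H H
  let K : Submodule ℂ (WithLp 2 (H × H)) := N.graph.comap (e : WithLp 2 (H × H) →ₗ[ℂ] H × H)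
  have hK : IsClosed (K : Set (WithLp 2 (H × H))) := by
    have : IsClosed (N.graph : Set (H × H)) := hc
    exact this.preimage e.continuous
  have : CompleteSpace K := hK.completeSpace_coe
  let P : H →L[ℂ] H × H := (e : WithLp 2 (H × H) →L[ℂ] H × H) ∘L K.starProjection ∘L
    (e.symm : H × H →L[ℂ] WithLp 2 (H × H)) ∘L ContinuousLinearMap.inl ℂ H H
  have hP : ∀ h, P h ∈ N.graph := fun h => K.starProjection_apply_mem _
  refine ⟨ContinuousLinearMap.fst ℂ H H ∘L P, ContinuousLinearMap.snd ℂ H H ∘L P, ?_, ?_⟩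
  · intro h
    exact hP h
  · intro h
    rw [fpaux_mem_adj hd]
    intro a b hab
    have := K.starProjection_inner_eq_zero (e.symm (h, 0)) (e.symm (a, b))
      (by change e (e.symm (a, b)) ∈ N.graph; simpa using hab)
    rw [WithLp.prod_inner_apply] at this
    have h3 : inner ℂ (h - (P h).1) a + inner ℂ (0 - (P h).2) b = 0 := this
    rw [zero_sub, inner_neg_left, ← sub_eq_add_neg, sub_eq_zero] at h3
    change inner ℂ b (P h).2 = inner ℂ a (h - (P h).1)
    rw [← inner_conj_symm, ← h3, inner_conj_symm]

theorem fpaux_normal {N : H →ₗ.[ℂ] H} (hN : N.IsNormalOp) :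
    ∃ B C : H →L[ℂ] H, 0 ≤ B ∧ (∀ h, B h = 0 → h = 0) ∧ IsStarNormal C ∧ Commute B C ∧
      (∀ h, (B h, C h) ∈ N.graph) ∧ (∀ h, (C h, h - B h) ∈ N.adjoint.graph) ∧
      (∀ h, (B h, star C h) ∈ N.adjoint.graph) ∧ (∀ h, (star C h, h - B h) ∈ N.graph) := by
  obtain ⟨hd, hc, hn⟩ := hN
  obtain ⟨B, C, h1, h2⟩ := fpaux_resolvent hd hc
  have adj : ∀ a b y w, (a, b) ∈ N.graph → (y, w) ∈ N.adjoint.graph →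
      inner ℂ b y = inner ℂ a w := fun a b y w hab hyw => (fpaux_mem_adj hd y w).1 hyw a b hab
  have adj' : ∀ a b y w, (a, b) ∈ N.graph → (y, w) ∈ N.adjoint.graph →
      inner ℂ y b = inner ℂ w a := fun a b y w hab hyw => by
    rw [← inner_conj_symm, adj a b y w hab hyw, inner_conj_symm]
  have swap : ∀ x z, (∃ y, (x, y) ∈ N.graph ∧ (y, z) ∈ N.adjoint.graph) ↔
      (∃ y, (x, y) ∈ N.adjoint.graph ∧ (y, z) ∈ N.graph) := fun x z => by
    rw [← fpaux_mem_graph_pcomp, ← fpaux_mem_graph_pcomp, hn]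
  -- `B = B* B + C* C`
  have hBB : ∀ h k, inner ℂ h (B k) = inner ℂ (B h) (B k) + inner ℂ (C h) (C k) := fun h k => by
    have := adj' _ _ _ _ (h1 k) (h2 h)
    rw [this, inner_sub_left]; ring
  have hBB' : ∀ h k, inner ℂ (B h) k = inner ℂ (B h) (B k) + inner ℂ (C h) (C k) := fun h k => by
    have := adj _ _ _ _ (h1 h) (h2 k)
    rw [this, inner_sub_right]; ring
  have hBsymm : ∀ h k, inner ℂ (B h) k = inner ℂ h (B k) := fun h k => by rw [hBB, hBB']
  have hB0 : 0 ≤ B := by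
    rw [ContinuousLinearMap.nonneg_iff_isPositive, ContinuousLinearMap.isPositive_iff]
    refine ⟨hBsymm, fun x => ?_⟩
    have e : inner ℂ (B x) x = ((‖B x‖ ^ 2 + ‖C x‖ ^ 2 : ℝ) : ℂ) := by
      rw [hBB', inner_self_eq_norm_sq_to_K, inner_self_eq_norm_sq_to_K]
      simp
    rw [e]
    exact Complex.zero_le_real.2 (by positivity)
  have hBinj : ∀ h, B h = 0 → h = 0 := fun h hh => by
    have hC : C h = 0 := by
      have := h1 h
      rw [hh] at this
      exact LinearPMap.graph_fst_eq_zero_snd _ this rfl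
    have := h2 h
    rw [hh, hC] at this
    simpa using LinearPMap.graph_fst_eq_zero_snd _ this rfl
  -- the dual side
  have hE : ∀ h, ∃ y, (B h, y) ∈ N.adjoint.graph ∧ (y, h - B h) ∈ N.graph := fun h =>
    (swap _ _).1 ⟨C h, h1 h, h2 h⟩
  have hstar : ∀ h, (B h, star C h) ∈ N.adjoint.graph ∧ (star C h, h - B h) ∈ N.graph := fun h => by
    obtain ⟨y, hy1, hy2⟩ := hE h
    have : star C h = y := by
      refine ext_inner_left ℂ fun w => ?_
      rw [ContinuousLinearMap.star_eq_adjoint, ContinuousLinearMap.adjoint_inner_right]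
      have e1 := adj _ _ _ _ (h1 w) hy1
      have e2 := adj' _ _ _ _ hy2 (h2 w)
      rw [inner_sub_right, e1, inner_sub_left] at e2
      linear_combination e2
    rw [this]
    exact ⟨hy1, hy2⟩
  -- uniqueness
  have huniq : ∀ u v h, (u, v) ∈ N.graph → (v, h - u) ∈ N.adjoint.graph → u = B h := by
    intro u v h hu hv
    have e1 := N.graph.sub_mem hu (h1 h)
    have e2 := N.adjoint.graph.sub_mem hv (h2 h)
    have e3 := adj _ _ _ _ e1 e2
    simp only [] at e3
    have e4 : (h - u) - (h - B h) = -(u - B h) := by abel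
    rw [e4, inner_neg_right, inner_self_eq_norm_sq_to_K, inner_self_eq_norm_sq_to_K] at e3
    have e5 : ‖v - C h‖ ^ 2 = - ‖u - B h‖ ^ 2 := by exact_mod_cast e3
    have e6 : ‖u - B h‖ ^ 2 = 0 := by nlinarith [sq_nonneg ‖v - C h‖, sq_nonneg ‖u - B h‖]
    rw [← sub_eq_zero, ← norm_eq_zero]
    exact pow_eq_zero_iff (two_ne_zero) |>.1 e6
  have hcomm : ∀ h, C (B h) = B (C h) := by
    intro h
    -- v = B B h, N v = C B h
    have a1 : (B h - B (B h), C h - C (B h)) ∈ N.graph := N.graph.sub_mem (h1 h) (h1 (B h))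
    obtain ⟨y, b1, b2⟩ := (swap _ _).2 ⟨_, h2 (B h), a1⟩
    exact huniq _ _ _ b1 b2
  refine ⟨B, C, hB0, hBinj, ⟨?_⟩, ?_, h1, h2, fun h => (hstar h).1, fun h => (hstar h).2⟩
  · ext h
    refine ext_inner_left ℂ fun w => ?_
    have e1 := adj _ _ _ _ (h1 w) (h2 h)
    have e2 := adj' _ _ _ _ (hstar h).2 (hstar w).1
    have e3 : inner ℂ w ((star C * C) h) = inner ℂ (C w) (C h) := by
      change inner ℂ w (star C (C h)) = _
      rw [ContinuousLinearMap.star_eq_adjoint, ContinuousLinearMap.adjoint_inner_right]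
    have e4 : inner ℂ w ((C * star C) h) = inner ℂ (star C w) (star C h) := by
      change inner ℂ w (C (star C h)) = _
      rw [ContinuousLinearMap.star_eq_adjoint, ContinuousLinearMap.adjoint_inner_left]
    rw [e3, e4, e1, e2]
  · ext h
    exact (hcomm h).symm

theorem fpaux_cutoff (B : H →L[ℂ] H) (hB : 0 ≤ B) (ε : ℝ) (hε : 0 < ε) :
    ∃ P k : H →L[ℂ] H, IsSelfAdjoint k ∧ ‖P - B‖ ≤ ε ∧
      (∀ C, Commute B C → Commute P C ∧ Commute k C) ∧ P * k * B = P := by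
  have hsa : IsSelfAdjoint B := hB.isSelfAdjoint
  have hc1 : Continuous fun x : ℝ => max (x - ε) 0 := by fun_prop
  have hne : ∀ x : ℝ, max x ε ≠ 0 := fun x => (lt_of_lt_of_le hε (le_max_right _ _)).ne'
  have hc2 : Continuous fun x : ℝ => (max x ε)⁻¹ := by
    exact (continuous_id.max continuous_const).inv₀ hne
  refine ⟨cfc (fun x : ℝ => max (x - ε) 0) B, cfc (fun x : ℝ => (max x ε)⁻¹) B,
    cfc_predicate _ _, ?_, ?_, ?_⟩
  · nth_rw 2 [← cfc_id' ℝ B]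
    rw [← cfc_sub _ _ B hc1.continuousOn (continuousOn_id' _)]
    refine norm_cfc_le hε.le fun x hx => ?_
    have hx0 : 0 ≤ x := spectrum_nonneg_of_nonneg hB hx
    rw [Real.norm_eq_abs, abs_le]
    rcases max_cases (x - ε) 0 with h | h <;> constructor <;> linarith [h.1, h.2]
  · intro C hC
    exact ⟨hsa.commute_cfc hC _, hsa.commute_cfc hC _⟩
  · nth_rw 3 [← cfc_id' ℝ B]
    rw [← cfc_mul _ _ B hc1.continuousOn hc2.continuousOn,
      ← cfc_mul _ _ B (hc1.fun_mul hc2).continuousOn (continuousOn_id' _)]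
    congr 1
    funext x
    rcases le_total x ε with h | h
    · rw [max_eq_right (by linarith : x - ε ≤ 0)]; simp
    · rw [max_eq_left h]
      have : x ≠ 0 := (lt_of_lt_of_le hε h).ne'
      field_simp

theorem fpaux_bounded (A B C B' D : H →L[ℂ] H) (hB : 0 ≤ B) (hB' : 0 ≤ B')
    (hi : ∀ h, B h = 0 → h = 0) (hi' : ∀ h, B' h = 0 → h = 0)
    (hC : IsStarNormal C) (hD : IsStarNormal D) (hBC : Commute B C) (hBD : Commute B' D)
    (h : B' * A * C = D * A * B) : B' * A * star C = star D * A * B := by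
  have hBC' : Commute B (star C) := hC.commute_star_right hBC
  have hBD' : Commute B' (star D) := hD.commute_star_right hBD
  have step : ∀ ε : ℝ, 0 < ε → ∃ P Q : H →L[ℂ] H, ‖P - B‖ ≤ ε ∧ ‖Q - B'‖ ≤ ε ∧
      B' * Q * A * star C * P = star D * Q * A * P * B := by
    intro ε hε
    obtain ⟨P, k, ksa, hP, hcP, hPk⟩ := fpaux_cutoff B hB ε hε
    obtain ⟨Q, l, lsa, hQ, hcQ, hQl⟩ := fpaux_cutoff B' hB' ε hε
    refine ⟨P, Q, hP, hQ, ?_⟩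
    have cPC := (hcP C hBC).1.eq
    have ckC := (hcP C hBC).2.eq
    have cPC' := (hcP _ hBC').1.eq
    have ckC' := (hcP _ hBC').2.eq
    have cPB := (hcP B rfl).1
    have ckB := (hcP B rfl).2
    have ckP : Commute k P := (hcP k ckB.symm).1.symm
    have cQD := (hcQ D hBD).1.eq
    have clD := (hcQ D hBD).2.eq
    have cQD' := (hcQ _ hBD').1.eq
    have clD' := (hcQ _ hBD').2.eq
    have cQB := (hcQ B' rfl).1
    have clB := (hcQ B' rfl).2
    have clQ : Commute l Q := (hcQ l clB.symm).1.symm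
    have n1 : IsStarNormal (C * k) := by
      constructor
      rw [star_mul, ksa.star_eq]
      have := hC.star_comm_self.eq
      change k * star C * (C * k) = C * k * (k * star C)
      grind
    have n2 : IsStarNormal (D * l) := by
      constructor
      rw [star_mul, lsa.star_eq]
      have := hD.star_comm_self.eq
      change l * star D * (D * l) = D * l * (l * star D)
      grind
    have hX : SemiconjBy (Q * A * P) (C * k) (D * l) := by
      change Q * A * P * (C * k) = D * l * (Q * A * P)
      calc Q * A * P * (C * k) = (Q * l * B') * A * (P * C) * k := by rw [hQl]; noncomm_ring
        _ = Q * l * (B' * A * C) * (P * k) := by rw [cPC]; noncomm_ring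
        _ = (Q * (l * D)) * A * (B * (P * k)) := by rw [h]; noncomm_ring
        _ = (Q * D) * l * A * (P * k * B) := by
            rw [clD, (cPB.mul_left ckB).eq]; noncomm_ring
        _ = D * (Q * l) * A * P := by rw [cQD, hPk]; noncomm_ring
        _ = D * l * (Q * A * P) := by rw [← clQ.eq]; noncomm_ring
    have hY : Q * A * P * star (C * k) = star (D * l) * (Q * A * P) := hX.star_right n1 n2
    rw [star_mul, star_mul, ksa.star_eq, lsa.star_eq] at hY
    calc B' * Q * A * star C * P = B' * Q * A * (P * star C) := by rw [cPC']; noncomm_ring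
      _ = B' * Q * A * (P * k * B * star C) := by rw [hPk]
      _ = B' * (Q * A * P * (k * (B * star C))) := by noncomm_ring
      _ = B' * (Q * A * P * (k * star C)) * B := by rw [hBC'.eq]; noncomm_ring
      _ = (B' * l) * star D * Q * A * P * B := by rw [hY]; noncomm_ring
      _ = (B' * l) * (star D * Q) * A * P * B := by noncomm_ring
      _ = (B' * (l * Q)) * star D * A * P * B := by rw [← cQD']; noncomm_ring
      _ = (Q * l * B') * star D * A * P * B := by
          rw [clQ.eq, (cQB.mul_left clB).eq]
      _ = star D * Q * A * P * B := by rw [hQl, cQD']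
  choose! P Q hP hQ hPQ using step
  have ht : Filter.Tendsto (fun n : ℕ => 1 / ((n : ℝ) + 1)) Filter.atTop (nhds 0) :=
    tendsto_one_div_add_atTop_nhds_zero_nat
  have hpos : ∀ n : ℕ, 0 < 1 / ((n : ℝ) + 1) := fun n => by positivity
  have tP : Filter.Tendsto (fun n : ℕ => P (1 / ((n : ℝ) + 1))) Filter.atTop (nhds B) := by
    rw [tendsto_iff_norm_sub_tendsto_zero]
    exact squeeze_zero (fun _ => norm_nonneg _) (fun n => hP _ (hpos n)) ht
  have tQ : Filter.Tendsto (fun n : ℕ => Q (1 / ((n : ℝ) + 1))) Filter.atTop (nhds B') := by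
    rw [tendsto_iff_norm_sub_tendsto_zero]
    exact squeeze_zero (fun _ => norm_nonneg _) (fun n => hQ _ (hpos n)) ht
  have l1 := (((tQ.const_mul B').mul_const A).mul_const (star C)).mul tP
  have l2 := (((tQ.const_mul (star D)).mul_const A).mul tP).mul_const B
  have l3 : B' * B' * A * star C * B = star D * B' * A * B * B := by
    refine tendsto_nhds_unique l1 (l2.congr fun n => ?_)
    exact (hPQ _ (hpos n)).symm
  have l4 : B' * (B' * A * star C - star D * A * B) * B = 0 := by
    have : B' * (B' * A * star C - star D * A * B) * B =
      B' * B' * A * star C * B - (B' * star D) * A * B * B := by noncomm_ring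
    rw [this, l3, hBD'.eq, sub_self]
  set Z := B' * A * star C - star D * A * B with hZ
  have l5 : Z * B = 0 := by
    ext x
    exact hi' _ (congrArg (fun T : H →L[ℂ] H => T x) l4)
  have l6 : B * star Z = 0 := by
    rw [← hB.isSelfAdjoint.star_eq, ← star_mul, l5, star_zero]
  have l7 : star Z = 0 := by
    ext x
    exact hi _ (congrArg (fun T : H →L[ℂ] H => T x) l6)
  exact sub_eq_zero.1 (star_eq_zero.1 l7)

/-- **Fuglede–Putnam theorem.** If `A` is a bounded operator on a complex Hilbert space and
`M, N` are (possibly unbounded) normal operators with `A N ⊆ M A`, then `A N* ⊆ M* A`. -/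
theorem fuglede_putnam (A : H →L[ℂ] H) (N M : H →ₗ.[ℂ] H)
    (hN : N.IsNormalOp) (hM : M.IsNormalOp)
    (h : A.toPMapTop.pcomp N ≤ M.pcomp A.toPMapTop) :
    A.toPMapTop.pcomp N.adjoint ≤ M.adjoint.pcomp A.toPMapTop := by
  obtain ⟨B, C, hB, hi, hC, hBC, n1, n2, n3, n4⟩ := fpaux_normal hN
  obtain ⟨B', D, hB', hi', hD, hBD, m1, m2, m3, m4⟩ := fpaux_normal hM
  have hAN : ∀ x y, (x, y) ∈ N.graph → (A x, A y) ∈ M.graph := by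
    intro x y hxy
    have := LinearPMap.le_graph_of_le h
      ((fpaux_mem_graph_pcomp _ _ x (A y)).2 ⟨y, hxy, (fpaux_mem_graph_top A _ _).2 rfl⟩)
    obtain ⟨w, hw1, hw2⟩ := (fpaux_mem_graph_pcomp _ _ _ _).1 this
    rw [fpaux_mem_graph_top] at hw1
    rwa [hw1]
  have sB : ∀ x y, inner ℂ (B x) y = inner ℂ x (B y) := fun x y => by
    conv_lhs => rw [← hB.isSelfAdjoint.star_eq]
    rw [ContinuousLinearMap.star_eq_adjoint, ContinuousLinearMap.adjoint_inner_left]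
  have sB' : ∀ x y, inner ℂ (B' x) y = inner ℂ x (B' y) := fun x y => by
    conv_lhs => rw [← hB'.isSelfAdjoint.star_eq]
    rw [ContinuousLinearMap.star_eq_adjoint, ContinuousLinearMap.adjoint_inner_left]
  have hBM : ∀ x y, (x, y) ∈ M.graph → B' y = D x := by
    intro x y hxy
    refine ext_inner_right ℂ fun w => ?_
    rw [sB', (fpaux_mem_adj hM.1 _ _).1 (m3 w) x y hxy, ContinuousLinearMap.star_eq_adjoint,
      ContinuousLinearMap.adjoint_inner_right]
  have key := fpaux_bounded A B C B' D hB hB' hi hi' hC hD hBC hBD (by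
    ext x
    exact hBM _ _ (hAN _ _ (n1 x)))
  -- `A` maps `ran B` into `dom M*`
  have hran : ∀ x, (A (B x), A (star C x)) ∈ M.adjoint.graph := by
    intro x
    have e : B' (A (star C x)) = star D (A (B x)) :=
      congrArg (fun T : H →L[ℂ] H => T x) key
    set y := A (B x)
    set s := A (star C x)
    have g1 := m4 y
    rw [← e] at g1
    have g2 : y - B' y = D s := LinearPMap.mem_graph_snd_inj _ g1 (m1 s) rfl
    have g3 := M.adjoint.graph.add_mem (m3 y) (m2 s)
    rw [← g2, ← e] at g3
    simpa using g3
  have hdual : ∀ a b, (a, b) ∈ M.graph → (star A a, star A b) ∈ N.graph := by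
    intro a b hab
    have e : B (star A b) = C (star A a) := by
      refine ext_inner_right ℂ fun w => ?_
      have e1 := (fpaux_mem_adj hM.1 _ _).1 (hran w) a b hab
      rw [sB, ContinuousLinearMap.star_eq_adjoint, ContinuousLinearMap.adjoint_inner_left, e1,
        ← ContinuousLinearMap.adjoint_inner_left A, ContinuousLinearMap.star_eq_adjoint,
        ContinuousLinearMap.adjoint_inner_right]
    set q := star A a
    set p := star A b
    have g1 := n3 p
    rw [e] at g1
    have g2 : star C p = q - B q := LinearPMap.mem_graph_snd_inj _ g1 (n2 q) rfl
    have g3 := N.graph.add_mem (n1 q) (n4 p)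
    rw [g2, ← e] at g3
    simpa using g3
  apply LinearPMap.le_of_le_graph
  rintro ⟨u, v⟩ huv
  obtain ⟨w, hw1, hw2⟩ := (fpaux_mem_graph_pcomp _ _ _ _).1 huv
  rw [fpaux_mem_graph_top] at hw2
  subst hw2
  refine (fpaux_mem_graph_pcomp _ _ _ _).2 ⟨A u, (fpaux_mem_graph_top A _ _).2 rfl, ?_⟩
  rw [fpaux_mem_adj hM.1]
  intro a b hab
  have := (fpaux_mem_adj hN.1 _ _).1 hw1 _ _ (hdual a b hab)
  rwa [ContinuousLinearMap.star_eq_adjoint, ContinuousLinearMap.adjoint_inner_left,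
    ContinuousLinearMap.adjoint_inner_left] at this
end

section
/- Fuglede's theorem: if A is a bounded operator and N is a (possibly unbounded) normal operator with AN ⊆ NA, then AN* ⊆ N*A. -/
open LinearPMap

namespace Fug
noncomputable def f (n : ℕ) (t : ℝ) : ℝ := min 1 (max 0 (n * |t| - 1))
noncomputable def g (n : ℕ) (t : ℝ) : ℝ := f n t * t / max (t^2) (1/(n+1)^2)

lemma f_cont (n) : Continuous (f n) := by unfold f; fun_prop
lemma g_cont (n) : Continuous (g n) := by
  unfold g
  refine Continuous.div (by have := f_cont n; fun_prop) (by fun_prop) fun t => ?_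
  have : (0:ℝ) < 1/(n+1)^2 := by positivity
  exact (lt_max_of_lt_right this).ne'

lemma f_eq_zero {n : ℕ} {t : ℝ} (h : n * |t| ≤ 1) : f n t = 0 := by
  unfold f; rw [max_eq_left (by linarith)]; simp
lemma f_eq_one {n : ℕ} {t : ℝ} (h : 2 ≤ n * |t|) : f n t = 1 := by
  unfold f; rw [max_eq_right (by linarith), min_eq_left (by linarith)]
lemma f_mul {n k : ℕ} (h : 2 * n ≤ k) (t : ℝ) : f k t * f n t = f n t := by
  rcases le_or_gt (n * |t|) 1 with h1 | h1
  · simp [f_eq_zero h1]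
  · rw [f_eq_one, one_mul]
    have : (2 * n : ℝ) ≤ k := by exact_mod_cast h
    nlinarith [abs_nonneg t]
lemma g_mul (n : ℕ) (t : ℝ) : t * g n t = f n t := by
  unfold g
  rcases le_or_gt (n * |t|) 1 with h1 | h1
  · simp [f_eq_zero h1]
  · have hn : (0:ℝ) ≤ n := n.cast_nonneg
    have ht : 0 < |t| := by
      by_contra hh
      have : |t| = 0 := le_antisymm (not_lt.1 hh) (abs_nonneg t)
      rw [this] at h1; norm_num at h1
    have ht0 : t ≠ 0 := abs_pos.1 ht
    rw [max_eq_left]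
    · field_simp
    · rw [div_le_iff₀ (by positivity), ← sq_abs t, ← mul_pow]
      apply one_le_pow₀
      nlinarith
lemma fg {n k : ℕ} (h : 2 * n ≤ k) (t : ℝ) : g k t * f n t = g n t := by
  by_cases ht : t = 0
  · simp [ht, g]
  · apply mul_left_cancel₀ ht
    rw [← mul_assoc, g_mul, g_mul, f_mul h]
lemma f_bound (n : ℕ) (t : ℝ) : |f (n+1) t * t - t| ≤ 2 / (n+1) := by
  have h0 : 0 ≤ f (n+1) t := by unfold f; positivity
  have h1 : f (n+1) t ≤ 1 := by unfold f; exact min_le_left _ _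
  rcases le_or_gt 2 ((n+1 : ℕ) * |t|) with h2 | h2
  · rw [f_eq_one h2]; simp; positivity
  · push_cast at h2
    rw [le_div_iff₀ (by positivity), show f (n+1) t * t - t = (f (n+1) t - 1) * t by ring, abs_mul]
    have : |f (n+1) t - 1| ≤ 1 := by rw [abs_le]; constructor <;> linarith
    nlinarith [abs_nonneg t, mul_le_mul_of_nonneg_right this (abs_nonneg t), (n.cast_nonneg : (0:ℝ) ≤ n)]

open Filter Topology in
lemma bdd {R : Type*} [CStarAlgebra R] {A B C : R} (hB : IsSelfAdjoint B) (hC : IsStarNormal C) (hBC : Commute B C)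
    (h : B * A * C = C * A * B) : B * (B * A * star C - star C * A * B) * B = 0 := by
  have key : ∀ n : ℕ, (cfc (f n) B * B) * (B * A * star C - star C * A * B) * (B * cfc (f n) B) = 0 := by
    intro n
    set F := cfc (f n) B
    set G := cfc (g n) B
    set K := cfc (g (2*n)) B
    have cf := fun n => (f_cont n).continuousOn (s := spectrum ℝ B)
    have cg := fun n => (g_cont n).continuousOn (s := spectrum ℝ B)
    have hBC' : Commute B (star C) := by
      have := hBC.star_star
      rwa [hB.star_eq] at this
    have hBG : B * G = F := by
      conv_lhs => rw [← cfc_id ℝ B]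
      rw [← cfc_mul _ _ _ (by fun_prop) (cg n)]
      simp [g_mul, F]
    have hKF : K * F = G := by
      rw [← cfc_mul _ _ _ (cg _) (cf n)]
      exact cfc_congr fun t _ => fg le_rfl t
    have cBG : Commute B G := ((Commute.refl B).cfc_real _).symm
    have cBF : Commute B F := ((Commute.refl B).cfc_real _).symm
    have cKF : Commute K F := cfc_commute_cfc _ _ _
    have cCG : Commute G C := hBC.cfc_real _
    have cCF : Commute F C := hBC.cfc_real _
    have cCK : Commute K C := hBC.cfc_real _
    have cDG : Commute G (star C) := hBC'.cfc_real _
    have cDF : Commute F (star C) := hBC'.cfc_real _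
    have cDK : Commute K (star C) := hBC'.cfc_real _
    have sK : star K = K := (cfc_predicate _ _ : IsSelfAdjoint K).star_eq
    have hnorm : IsStarNormal (C * K) := by
      refine ⟨?_⟩
      rw [star_mul, sK]
      exact ((cDK.symm.mul_left (Commute.refl K |>.symm.symm)).symm.symm |> fun _ =>
        ((Commute.refl K).mul_left cDK.symm |> fun hK =>
          (cCK.mul_left hC.star_comm_self).mul_right hK))
    have hFK : F * K = G := by rw [← cKF.eq, hKF]
    have hGB : G * B = F := by rw [← cBG.eq, hBG]
    have h1 : Commute (F * A * F) (C * K) := by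
      calc F * A * F * (C * K) = F * A * (F * C) * K := by noncomm_ring
        _ = F * A * C * (F * K) := by rw [cCF.eq]; noncomm_ring
        _ = G * (B * A * C) * G := by rw [hFK, ← hGB]; noncomm_ring
        _ = (G * C) * A * (B * G) := by rw [h]; noncomm_ring
        _ = C * (K * F) * A * F := by rw [cCG.eq, hBG, hKF]
        _ = C * K * (F * A * F) := by noncomm_ring
    have h2 := (hnorm.commute_star_right h1).eq
    have h3 : F * A * star C * G = star C * G * A * F := by
      rw [star_mul, sK] at h2
      calc F * A * star C * G = F * A * (G * star C) := by rw [cDG.eq]; noncomm_ring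
        _ = F * A * F * (K * star C) := by rw [← hFK]; noncomm_ring
        _ = (K * star C) * F * A * F := by rw [h2]; noncomm_ring
        _ = star C * (K * F) * A * F := by rw [cDK.eq]; noncomm_ring
        _ = star C * G * A * F := by rw [hKF]
    have h4 : B * F = G * (B * B) := by rw [← mul_assoc, hGB, cBF.eq]
    have h5 : F * B = B * B * G := by rw [mul_assoc, hBG, cBF.eq]
    calc _ = (F * B) * B * A * star C * (B * F) - F * B * star C * A * B * (B * F) := by
            noncomm_ring
      _ = B * (B * F) * A * star C * (G * (B * B)) - B * B * (G * star C) * A * B * (F * B) := by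
            have e1 : F * B * B * A * star C * (B * F)
                = B * (B * F) * A * star C * (G * (B * B)) := by
              rw [← h4, ← cBF.eq, mul_assoc B F B, ← cBF.eq]
            have e2 : F * B * star C * A * B * (B * F)
                = B * B * (G * star C) * A * B * (F * B) := by
              rw [cBF.eq, ← mul_assoc (B * B) G, ← h5]
            rw [e1, e2]
      _ = B * B * (F * A * star C * G) * (B * B) - B * B * (star C * G) * A * (B * F) * B := by
            rw [cDG.eq]; noncomm_ring
      _ = 0 := by rw [h3, cBF.eq]; noncomm_ring
  have lim : Tendsto (fun n : ℕ => cfc (f (n+1)) B * B) atTop (𝓝 B) := by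
    rw [tendsto_iff_norm_sub_tendsto_zero]
    have h0 : Tendsto (fun n : ℕ => (2:ℝ) / (n+1)) atTop (𝓝 0) := by
      have := (tendsto_one_div_add_atTop_nhds_zero_nat (𝕜 := ℝ)).const_mul 2
      simpa [div_eq_mul_inv] using this
    refine squeeze_zero (fun _ => norm_nonneg _) (fun n => ?_) h0
    have hf := (f_cont (n+1)).continuousOn (s := spectrum ℝ B)
    have : cfc (f (n+1)) B * B - B = cfc (fun t => f (n+1) t * t - t) B := by
      rw [cfc_sub (fun t => f (n+1) t * t) (fun t => t) B (by fun_prop) (by fun_prop),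
        cfc_mul (f (n+1)) (fun t => t) B hf (by fun_prop), cfc_id' ℝ B]
    rw [this]
    exact norm_cfc_le (by positivity) fun t _ => f_bound n t
  have lim' : Tendsto (fun n : ℕ => B * cfc (f (n+1)) B) atTop (𝓝 B) := by
    refine lim.congr fun n => ?_
    exact ((Commute.refl B).cfc_real _).eq
  refine tendsto_nhds_unique ((lim.mul_const (B * A * star C - star C * A * B)).mul lim') ?_
  simp_rw [key]
  exact tendsto_const_nhds
end Fug

namespace Fug
variable {H : Type*} [NormedAddCommGroup H] [InnerProductSpace ℂ H]

lemma graph_pcomp (T S : H →ₗ.[ℂ] H) (x z : H) :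
    (x, z) ∈ (T.pcomp S).graph ↔ ∃ y, (x, y) ∈ S.graph ∧ (y, z) ∈ T.graph := by
  have key : ∀ (u : S.domain) (hu : S u ∈ T.domain) (hu' : (u : H) ∈ (T.pcomp S).domain),
      (T.pcomp S) ⟨u, hu'⟩ = T ⟨S u, hu⟩ := by
    intro u hu hu'
    have : (Submodule.equivMapOfInjective S.domain.subtype S.domain.injective_subtype
      (Submodule.comap S.toFun T.domain)).symm ⟨u, hu'⟩ = ⟨u, hu⟩ := by
      rw [LinearEquiv.symm_apply_eq]; rfl
    change T.toFun ((S.toFun.restrict (fun _ hx => hx : ∀ x ∈ Submodule.comap S.toFun T.domain, S.toFun x ∈ T.domain)) ((Submodule.equivMapOfInjective S.domain.subtype S.domain.injective_subtype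
      (Submodule.comap S.toFun T.domain)).symm ⟨u, hu'⟩)) = _
    rw [this]; rfl
  constructor
  · intro h
    rw [LinearPMap.mem_graph_iff] at h
    obtain ⟨⟨w, hw⟩, h1, h2⟩ := h
    obtain ⟨u, hu, rfl⟩ := hw
    simp only at h1 h2
    subst h1
    refine ⟨S u, LinearPMap.mem_graph S u, ?_⟩
    rw [← h2]
    erw [key u hu]
    exact LinearPMap.mem_graph T ⟨S u, hu⟩
  · rintro ⟨y, h1, h2⟩
    rw [LinearPMap.mem_graph_iff] at h1 h2
    obtain ⟨u, h1, h3⟩ := h1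
    obtain ⟨v, h2, h4⟩ := h2
    simp only at h1 h2 h3 h4
    subst h1 h3
    have hu : S u ∈ T.domain := h2 ▸ v.2
    have hu' : (u : H) ∈ (T.pcomp S).domain := ⟨u, hu, rfl⟩
    rw [LinearPMap.mem_graph_iff]
    refine ⟨⟨u, hu'⟩, rfl, ?_⟩
    rw [key u hu, ← h4]
    congr 1
    exact Subtype.ext h2.symm

lemma graph_top (A : H →L[ℂ] H) (x y : H) : (x, y) ∈ A.toPMapTop.graph ↔ y = A x := by
  rw [LinearPMap.mem_graph_iff]
  constructor
  · rintro ⟨u, h1, h2⟩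
    simp only at h1 h2
    rw [← h2, ← h1]; rfl
  · rintro rfl
    exact ⟨⟨x, trivial⟩, rfl, rfl⟩

variable [CompleteSpace H]

/-- Core lemma. -/
lemma core (G : Submodule ℂ (H × H)) (hG : IsClosed (G : Set (H × H)))
    (h0 : ∀ b, ((0 : H), b) ∈ G → b = 0) (B C : H →L[ℂ] H)
    (hBC : ∀ y, (B y, C y) ∈ G)
    (hin : ∀ x x' y, (x, x') ∈ G → inner ℂ (B y) x + inner ℂ (C y) x' = inner ℂ y x)
    {F : Type*} [NormedAddCommGroup F] [NormedSpace ℂ F] (T : H × H →L[ℂ] F)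
    (hT : ∀ y, T (B y, C y) = 0) : ∀ g ∈ G, T g = 0 := by
  let e := (WithLp.prodContinuousLinearEquiv 2 ℂ H H)
  let G' : Submodule ℂ (WithLp 2 (H × H)) := G.comap (e : WithLp 2 (H × H) →ₗ[ℂ] H × H)
  let S : H →ₗ[ℂ] WithLp 2 (H × H) := (e.symm : H × H →ₗ[ℂ] WithLp 2 (H × H)) ∘ₗ ((B : H →ₗ[ℂ] H).prod (C : H →ₗ[ℂ] H))
  let K := (LinearMap.range S).topologicalClosure
  have hG' : IsClosed (G' : Set (WithLp 2 (H × H))) := hG.preimage e.continuous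
  have hKG : K ≤ G' := by
    apply Submodule.topologicalClosure_minimal _ _ hG'
    rintro _ ⟨y, rfl⟩
    exact hBC y
  let L : Submodule ℂ (WithLp 2 (H × H)) := LinearMap.ker ((T ∘L (e : WithLp 2 (H × H) →L[ℂ] H × H)) : WithLp 2 (H × H) →ₗ[ℂ] F)
  have hL : IsClosed (L : Set (WithLp 2 (H × H))) := (T ∘L (e : WithLp 2 (H × H) →L[ℂ] H × H)).isClosed_ker
  have hKL : K ≤ L := by
    apply Submodule.topologicalClosure_minimal _ _ hL
    rintro _ ⟨y, rfl⟩
    exact hT y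
  have : CompleteSpace K := (Submodule.isClosed_topologicalClosure _).completeSpace_coe
  have hsup := Submodule.sup_orthogonal_inf_of_hasOrthogonalProjection hKG
  have hbot : Kᗮ ⊓ G' = ⊥ := by
    rw [eq_bot_iff]
    rintro w ⟨hw1, hw2⟩
    have hw2' : (w.fst, w.snd) ∈ G := hw2
    have hw3 : ∀ y, inner ℂ y w.fst = 0 := by
      intro y
      have := hw1 (S y) (Submodule.le_topologicalClosure _ ⟨y, rfl⟩)
      rw [← hin _ _ y hw2']
      rw [WithLp.prod_inner_apply] at this
      exact this
    have hw4 : w.fst = 0 := inner_self_eq_zero.1 (hw3 w.fst)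
    rw [hw4] at hw2'
    have hw5 := h0 _ hw2'
    rw [Submodule.mem_bot]
    apply e.injective
    rw [_root_.map_zero]
    exact Prod.ext hw4 hw5
  intro g hg
  rw [hbot, sup_bot_eq] at hsup
  have : e.symm g ∈ K := by rw [hsup]; exact hg
  exact hKL this

lemma exists_BC (G : Submodule ℂ (H × H)) (hG : IsClosed (G : Set (H × H))) :
    ∃ B C : H →L[ℂ] H, (∀ y, (B y, C y) ∈ G) ∧ 
      ∀ x x' y, (x, x') ∈ G → inner ℂ (B y) x + inner ℂ (C y) x' = inner ℂ y x := by
  let e := (WithLp.prodContinuousLinearEquiv 2 ℂ H H)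
  let G' : Submodule ℂ (WithLp 2 (H × H)) := G.comap (e : WithLp 2 (H × H) →ₗ[ℂ] H × H)
  have hG' : IsClosed (G' : Set (WithLp 2 (H × H))) := hG.preimage e.continuous
  have : CompleteSpace G' := hG'.completeSpace_coe
  let P : H →L[ℂ] H × H := (e : WithLp 2 (H × H) →L[ℂ] H × H) ∘L G'.starProjection ∘L
    (e.symm : H × H →L[ℂ] WithLp 2 (H × H)) ∘L (ContinuousLinearMap.inl ℂ H H)
  refine ⟨ContinuousLinearMap.fst ℂ H H ∘L P, ContinuousLinearMap.snd ℂ H H ∘L P, ?_, ?_⟩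
  · intro y
    exact G'.starProjection_apply_mem (e.symm (y, 0))
  · intro x x' y hx
    have := G'.sub_starProjection_mem_orthogonal (e.symm (y, 0))
    have := (Submodule.mem_orthogonal' _ _).1 this (e.symm (x, x')) hx
    rw [inner_sub_left, sub_eq_zero, WithLp.prod_inner_apply, WithLp.prod_inner_apply] at this
    have h2 : inner ℂ y x + inner ℂ (0:H) x' = inner ℂ ((ContinuousLinearMap.fst ℂ H H ∘L P) y) x + inner ℂ ((ContinuousLinearMap.snd ℂ H H ∘L P) y) x' := this
    rw [← h2]; simp

lemma main (G Gs : Submodule ℂ (H × H)) (hG : IsClosed (G : Set (H × H)))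
    (h0 : ∀ b, ((0 : H), b) ∈ G → b = 0)
    (hGs : IsClosed (Gs : Set (H × H))) (hs0 : ∀ b, ((0 : H), b) ∈ Gs → b = 0)
    (hadj : ∀ x y, (x, y) ∈ Gs ↔ ∀ a b, (a, b) ∈ G → inner ℂ b x = inner ℂ a y)
    (hnorm : ∀ x z, (∃ y, (x, y) ∈ G ∧ (y, z) ∈ Gs) ↔ (∃ y, (x, y) ∈ Gs ∧ (y, z) ∈ G))
    (A : H →L[ℂ] H) (hA : ∀ x y, (x, y) ∈ G → (A x, A y) ∈ G) :
    ∀ x y, (x, y) ∈ Gs → (A x, A y) ∈ Gs := by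
  obtain ⟨B, C, hBC, hin⟩ := exists_BC G hG
  have fG : ∀ {x y z}, (x, y) ∈ G → (x, z) ∈ G → y = z := by
    intro x y z h1 h2
    have := G.sub_mem h1 h2
    simp only [Prod.mk_sub_mk, sub_self] at this
    exact sub_eq_zero.1 (h0 _ this)
  have fGs : ∀ {x y z}, (x, y) ∈ Gs → (x, z) ∈ Gs → y = z := by
    intro x y z h1 h2
    have := Gs.sub_mem h1 h2
    simp only [Prod.mk_sub_mk, sub_self] at this
    exact sub_eq_zero.1 (hs0 _ this)
  have adj : ∀ {x y a b}, (x, y) ∈ Gs → (a, b) ∈ G → inner ℂ b x = inner ℂ a y :=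
    fun h1 h2 => (hadj _ _).1 h1 _ _ h2
  have adj' : ∀ {x y a b}, (x, y) ∈ Gs → (a, b) ∈ G → inner ℂ x b = inner ℂ y a := by
    intro x y a b h1 h2
    rw [← inner_conj_symm, adj h1 h2, inner_conj_symm]
  -- `N* C x = x - B x`
  have hNC : ∀ x, (C x, x - B x) ∈ Gs := by
    intro x
    rw [hadj]
    intro a b hab
    have := hin a b x hab
    rw [inner_sub_right, ← inner_conj_symm, ← inner_conj_symm a x, ← inner_conj_symm a (B x),
      ← this]
    simp
  -- `N N* B x = x - B x`
  have hD : ∀ x, ∃ y, (B x, y) ∈ Gs ∧ (y, x - B x) ∈ G := fun x =>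
    (hnorm _ _).1 ⟨_, hBC x, hNC x⟩
  have hBsa : ∀ x y, inner ℂ (B x) y = inner ℂ x (B y) := by
    intro x y
    have h1 := hin _ _ x (hBC y)
    have h2 := hin _ _ y (hBC x)
    rw [← h1, ← inner_conj_symm, ← h2]
    simp
  have hCad : ∀ x y d, (B y, d) ∈ Gs → (d, y - B y) ∈ G → inner ℂ (C x) y = inner ℂ x d := by
    intro x y d h1 h2
    have e1 := adj h1 (hBC x)
    have e2 := adj' (hNC x) h2
    rw [inner_sub_right, inner_sub_left] at e2
    linear_combination e2 + e1
  have hstar : ∀ y, (B y, star C y) ∈ Gs ∧ (star C y, y - B y) ∈ G := by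
    intro y
    obtain ⟨d, h1, h2⟩ := hD y
    have : star C y = d := by
      refine ext_inner_left ℂ fun x => ?_
      rw [← hCad x y d h1 h2, ContinuousLinearMap.star_eq_adjoint,
        ContinuousLinearMap.adjoint_inner_right]
    rw [this]; exact ⟨h1, h2⟩
  have uniq : ∀ v w z, (v, w) ∈ G → (w, z) ∈ Gs → v = B (v + z) := by
    intro v w z h1 h2
    refine ext_inner_left ℂ fun y => ?_
    rw [← hBsa, inner_add_right, ← adj h2 (hBC y), hin _ _ y h1]
  -- `B N u = N B u`
  have hcomm : ∀ u u', (u, u') ∈ G → B u' = C u := by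
    intro u u' hu
    have h1 : (u - B u, u' - C u) ∈ G := G.sub_mem hu (hBC u)
    obtain ⟨y, h2, h3⟩ := (hnorm (C u) (u' - C u)).2 ⟨_, hNC u, h1⟩
    have := uniq _ _ _ h2 h3
    rw [this]; simp
  have hBself : IsSelfAdjoint B := by
    rw [ContinuousLinearMap.isSelfAdjoint_iff_isSymmetric]
    exact hBsa
  have hBC1 : Commute B C := by
    ext x
    exact hcomm _ _ (hBC x)
  have hBC2 : Commute B (star C) := by
    have := hBC1.star_star
    rwa [hBself.star_eq] at this
  have hCn : IsStarNormal C := by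
    refine ⟨?_⟩
    ext x
    have e1 : star C (C x) = B x - B (B x) := by
      have h1 := (hstar (C x)).1
      have h2 : B (C x) = C (B x) := congr($(hBC1.eq) x)
      rw [h2] at h1
      exact fGs h1 (hNC (B x))
    have e2 : C (star C x) = B x - B (B x) := by
      have h1 := hBC (star C x)
      have h2 : B (star C x) = star C (B x) := congr($(hBC2.eq) x)
      rw [h2] at h1
      exact fG h1 (hstar (B x)).2
    exact e1.trans e2.symm
  have hBAC : B * A * C = C * A * B := by
    ext x
    exact hcomm _ _ (hA _ _ (hBC x))
  have hinj : ∀ x, B x = 0 → x = 0 := by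
    intro x hx
    have h1 := hBC x
    rw [hx] at h1
    have h2 := hNC x
    rw [h0 _ h1, hx, sub_zero] at h2
    exact hs0 _ h2
  have hz := bdd hBself hCn hBC1 hBAC
  have hz1 : ∀ y, B (A (star C y)) = star C (A (B y)) := by
    set Z := B * A * star C - star C * A * B with hZ
    have h1 : ∀ x, Z (B x) = 0 := fun x => hinj _ congr($hz x)
    have h2 : star Z = 0 := by
      ext x
      apply hinj
      refine ext_inner_left ℂ fun y => ?_
      rw [← hBsa, ContinuousLinearMap.star_eq_adjoint, ContinuousLinearMap.adjoint_inner_right, h1]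
      simp
    have h3 : Z = 0 := star_eq_zero.1 h2
    intro y
    have : Z y = 0 := by rw [h3]; rfl
    exact sub_eq_zero.1 this
  have hz2 : ∀ x y, (x, y) ∈ Gs → B (A y) = star C (A x) := by
    intro x y hxy
    have := core Gs hGs hs0 B (star C) (fun y => (hstar y).1)
      (by
        intro x x' y hx
        have e := adj' hx (hstar y).2
        have e' : inner ℂ (y - B y) x = inner ℂ (star C y) x' := adj hx (hstar y).2
        rw [← e', inner_sub_left]; ring)
      ((B * A) ∘L (ContinuousLinearMap.snd ℂ H H) - (star C * A) ∘L (ContinuousLinearMap.fst ℂ H H))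
      (fun y => by
        have := hz1 y
        simpa [sub_eq_zero] using this) (x, y) hxy
    simpa [sub_eq_zero] using this
  intro x y hxy
  rw [hadj]
  intro a b hab
  have := core G hG h0 B C hBC hin
      ((innerSL ℂ (A x)) ∘L (ContinuousLinearMap.snd ℂ H H)
        - (innerSL ℂ (A y)) ∘L (ContinuousLinearMap.fst ℂ H H))
      (fun z => by
        have e : inner ℂ (A y) (B z) = inner ℂ (A x) (C z) := by
          rw [← hBsa, hz2 x y hxy, ContinuousLinearMap.star_eq_adjoint,
            ContinuousLinearMap.adjoint_inner_left]
        simp [e]) (a, b) hab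
  have e : inner ℂ (A x) b = inner ℂ (A y) a := by simpa [sub_eq_zero] using this
  rw [← inner_conj_symm, e, inner_conj_symm]
end Fug

variable {H : Type*} [NormedAddCommGroup H] [InnerProductSpace ℂ H] [CompleteSpace H]

/-- **Fuglede's theorem.** If `A` is a bounded operator and `N` is a (possibly unbounded)
normal operator with `A N ⊆ N A`, then `A N* ⊆ N* A`. -/
theorem fuglede (A : H →L[ℂ] H) (N : H →ₗ.[ℂ] H) (hN : N.IsNormalOp)
    (h : A.toPMapTop.pcomp N ≤ N.pcomp A.toPMapTop) :
    A.toPMapTop.pcomp N.adjoint ≤ N.adjoint.pcomp A.toPMapTop := by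
  obtain ⟨hd, hc, hn⟩ := hN
  have hcs := LinearPMap.adjoint_isClosed hd
  rw [← LinearPMap.le_graph_iff] at h ⊢
  have hA : ∀ x y, (x, y) ∈ N.graph → (A x, A y) ∈ N.graph := by
    intro x y hxy
    have := h ((Fug.graph_pcomp A.toPMapTop N x (A y)).2 ⟨y, hxy, (Fug.graph_top A _ _).2 rfl⟩)
    obtain ⟨w, h1, h2⟩ := (Fug.graph_pcomp _ _ _ _).1 this
    rw [Fug.graph_top] at h1
    rwa [h1] at h2
  have key := Fug.main N.graph N.adjoint.graph hc
    (fun b hb => LinearPMap.graph_fst_eq_zero_snd N hb rfl) hcs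
    (fun b hb => LinearPMap.graph_fst_eq_zero_snd _ hb rfl)
    (fun x y => by
      rw [LinearPMap.adjoint_graph_eq_graph_adjoint hd, Submodule.mem_adjoint_iff]
      simp only [sub_eq_zero])
    (fun x z => by
      rw [← Fug.graph_pcomp, ← Fug.graph_pcomp, hn])
    A hA
  rintro ⟨x, z⟩ hxz
  obtain ⟨y, h1, h2⟩ := (Fug.graph_pcomp _ _ _ _).1 hxz
  rw [Fug.graph_top] at h2
  subst h2
  exact (Fug.graph_pcomp _ _ _ _).2 ⟨A x, (Fug.graph_top A _ _).2 rfl, key x y h1⟩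
end

section
/- If T is a closed densely defined operator and N is an unbounded normal operator with dom(N) ⊆ dom(T), then TN ⊆ N*T implies TN* ⊆ NT. -/
open LinearPMap

variable {H : Type*} [NormedAddCommGroup H] [InnerProductSpace ℂ H] [CompleteSpace H]

theorem FP.core {H : Type*} [NormedAddCommGroup H] [InnerProductSpace ℂ H] [CompleteSpace H]
    (R B C : H →L[ℂ] H) (hR0 : 0 ≤ R) (hinj : ∀ A : H →L[ℂ] H, R * A = 0 → A = 0)
    (hRB : R * B = B * R) (hBB : star B * B = R - R * R) (hBB' : B * star B = R - R * R)
    (h : R * C * B = star B * C * R) :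
    R * C = C * R ∧ B * C = C * star B := by
  have hRs : IsSelfAdjoint R := hR0.isSelfAdjoint
  have hRst : star R = R := hRs
  have hinj' : ∀ A : H →L[ℂ] H, A * R = 0 → A = 0 := by
    intro A hA
    have : R * star A = 0 := by
      have := congrArg star hA
      simpa [hRst] using this
    simpa using hinj _ this
  have hcan : ∀ A A' : H →L[ℂ] H, R * A = R * A' → A = A' := fun A A' e =>
    sub_eq_zero.1 (hinj _ (by rw [mul_sub, e, sub_self]))
  have hcan' : ∀ A A' : H →L[ℂ] H, A * R = A' * R → A = A' := fun A A' e =>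
    sub_eq_zero.1 (hinj' _ (by rw [sub_mul, e, sub_self]))
  have hRBs : R * star B = star B * R := by
    have := congrArg star hRB
    simpa [hRst] using this.symm
  have hspec : ∀ t ∈ spectrum ℝ R, 0 ≤ t := fun t ht => spectrum_nonneg_of_nonneg hR0 ht
  -- commutation facts
  have cB : ∀ f : ℝ → ℝ, cfc f R * B = B * cfc f R := fun f =>
    ((show Commute R B from hRB).cfc_real f).eq
  have cBs : ∀ f : ℝ → ℝ, cfc f R * star B = star B * cfc f R := fun f =>
    ((show Commute R (star B) from hRBs).cfc_real f).eq
  have cR : ∀ f : ℝ → ℝ, cfc f R * R = R * cfc f R := fun f =>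
    ((Commute.refl R).cfc_real f).eq
  have sa : ∀ f : ℝ → ℝ, star (cfc f R) = cfc f R := fun f => IsSelfAdjoint.cfc (f := f)
  have pcont : ∀ d : ℝ, 0 < d → Continuous (fun t : ℝ => (max t d)⁻¹) := fun d hd =>
    Continuous.inv₀ (by fun_prop) (fun t => ne_of_gt (lt_of_lt_of_le hd (le_max_right _ _)))
  have bnormal : ∀ f : ℝ → ℝ, IsStarNormal (B * cfc f R) := by
    intro f
    constructor
    show star (B * cfc f R) * (B * cfc f R) = (B * cfc f R) * star (B * cfc f R)
    rw [star_mul, sa]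
    calc cfc f R * star B * (B * cfc f R) = cfc f R * (star B * B) * cfc f R := by noncomm_ring
      _ = cfc f R * (B * star B) * cfc f R := by rw [hBB, hBB']
      _ = (cfc f R * B) * (star B * cfc f R) := by noncomm_ring
      _ = (B * cfc f R) * (cfc f R * star B) := by rw [cB, cBs]
  -- main
  have main : ∀ d : ℝ, 0 < d → R * (C * cfc (fun t : ℝ => max (t - d) 0) R) =
      (C * cfc (fun t : ℝ => max (t - d) 0) R) * R := by
    intro d hd
    set G := cfc (fun t : ℝ => max (t - d) 0) R with hG
    set P := cfc (fun t : ℝ => (max t d)⁻¹) R with hP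
    have hRPG : R * P * G = G := by
      have e1 : cfc (fun t : ℝ => t * (max t d)⁻¹ * max (t - d) 0) R = R * P * G := by
        rw [cfc_mul (fun t : ℝ => t * (max t d)⁻¹) _ R (by have := pcont d hd; fun_prop),
          cfc_mul (fun t : ℝ => t) _ R (by fun_prop) (pcont d hd).continuousOn, cfc_id' ℝ R]
      rw [← e1, hG]
      congr 1
      funext t
      rcases le_total t d with htd | htd
      · simp [max_eq_right (sub_nonpos.2 htd)]
      · have : t ≠ 0 := by linarith
        rw [max_eq_left htd]; field_simp
    have hPG : P * G = G * P := (cfc_commute_cfc _ _ R).eq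
    set X := C * G with hX
    set N' := B * P with hN'
    have hXN : R * X * N' = star B * X := by
      calc R * (C * G) * (B * P) = R * C * (G * B) * P := by noncomm_ring
        _ = R * C * B * (G * P) := by rw [hG, cB]; noncomm_ring
        _ = star B * C * (R * P * G) := by rw [h, ← hPG]; noncomm_ring
        _ = star B * (C * G) := by rw [hRPG]; noncomm_ring
    -- choose s
    obtain ⟨s, hs0, hs1, hs⟩ : ∃ s : ℝ, 0 < s ∧ s < 1 ∧ s * ‖N'‖ ^ 2 < 1 - s := by
      refine ⟨1 / (‖N'‖ ^ 2 + 2), by positivity, ?_, ?_⟩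
      · rw [div_lt_one (by positivity)]; nlinarith [sq_nonneg ‖N'‖]
      · rw [lt_sub_iff_add_lt, ← mul_add_one, one_div, inv_mul_lt_one₀ (by positivity)]; linarith
    set P2 := cfc (fun t : ℝ => (max t s)⁻¹) R with hP2
    have hh : cfc (fun t : ℝ => 1 - t * (max t s)⁻¹) R = 1 - R * P2 := by
      rw [cfc_sub (fun t : ℝ => 1) _ R (by fun_prop) (by have := pcont s hs0; fun_prop),
          cfc_mul (fun t : ℝ => t) _ R (by fun_prop) (pcont s hs0).continuousOn, cfc_id' ℝ R,
          cfc_const_one ℝ R]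
    set K := cfc (fun t : ℝ => 1 - t * (max t s)⁻¹) R with hK
    have hpos : 0 ≤ K * (s • R - R * R) * K := by
      have e1 : cfc (fun t : ℝ => (1 - t * (max t s)⁻¹) * (s * t - t * t) *
          (1 - t * (max t s)⁻¹)) R = K * (s • R - R * R) * K := by
        have := pcont s hs0
        rw [cfc_mul (fun t : ℝ => (1 - t * (max t s)⁻¹) * (s * t - t * t)) _ R (by fun_prop)
          (by fun_prop), cfc_mul (fun t : ℝ => (1 - t * (max t s)⁻¹)) _ R (by fun_prop)
          (by fun_prop), cfc_sub (fun t : ℝ => s * t) _ R (by fun_prop) (by fun_prop),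
          cfc_mul (fun t : ℝ => t) (fun t : ℝ => t) R (by fun_prop) (by fun_prop),
          cfc_const_mul s (fun t : ℝ => t) R (by fun_prop), cfc_id' ℝ R]
      rw [← e1]
      apply cfc_nonneg
      intro t ht
      have ht0 := hspec t ht
      rcases le_total t s with hts | hts
      · have : 0 ≤ s * t - t * t := by nlinarith
        have := mul_nonneg (mul_self_nonneg (1 - t * (max t s)⁻¹)) this
        nlinarith
      · have : t ≠ 0 := by linarith
        rw [max_eq_left hts, mul_inv_cancel₀ this]; simp
    have hKX : K * X = 0 := by
      apply hinj
      set Y := K * X with hY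
      have hYN : R * Y * N' = star B * Y := by
        calc R * (K * X) * N' = (R * K) * X * N' := by noncomm_ring
          _ = K * (R * X * N') := by rw [hK, ← cR]; noncomm_ring
          _ = K * star B * X := by rw [hXN]; noncomm_ring
          _ = star B * (K * X) := by rw [hK, cBs]; noncomm_ring
      have hest : ∀ u : H, (1 - s) * ‖(R * Y) u‖ ^ 2 ≤ s * ‖(star B * Y) u‖ ^ 2 := by
        intro u
        have h1 := ((ContinuousLinearMap.nonneg_iff_isPositive _).1 hpos).re_inner_nonneg_left (X u)
        have h2 : inner ℂ ((K * (s • R - R * R) * K) (X u)) (X u) =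
            inner ℂ ((s • R - R * R) (Y u)) (Y u) := by
          have : K = ContinuousLinearMap.adjoint K := (sa _).symm
          conv_lhs => rw [mul_assoc, mul_apply_eq_comp]
          rw [this, ContinuousLinearMap.adjoint_inner_left, ← this]; rfl
        have h3 : (‖(R * Y) u‖ : ℂ) ^ 2 = inner ℂ ((R * R) (Y u)) (Y u) := by
          have : R = ContinuousLinearMap.adjoint R := hRst.symm
          rw [mul_apply_eq_comp R R]
          nth_rw 2 [this]
          rw [ContinuousLinearMap.adjoint_inner_left]
          exact (inner_self_eq_norm_sq_to_K (𝕜 := ℂ) (R (Y u))).symm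
        have h4 : (‖(star B * Y) u‖ : ℂ) ^ 2 = inner ℂ ((R - R * R) (Y u)) (Y u) := by
          rw [← hBB', mul_apply_eq_comp B]
          rw [← ContinuousLinearMap.adjoint_inner_right]
          exact (inner_self_eq_norm_sq_to_K (𝕜 := ℂ) ((star B) (Y u))).symm
        have h5 : inner ℂ ((s • R - R * R) (Y u)) (Y u) =
            (s * ‖(star B * Y) u‖ ^ 2 - (1 - s) * ‖(R * Y) u‖ ^ 2 : ℂ) := by
          rw [h3, h4]
          simp only [_root_.sub_apply, _root_.smul_apply, inner_sub_left]
          rw [← Complex.coe_smul, inner_smul_left]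
          simp; ring
        rw [h2, h5] at h1
        have : (s * ‖(star B * Y) u‖ ^ 2 - (1 - s) * ‖(R * Y) u‖ ^ 2 : ℂ) =
          ((s * ‖(star B * Y) u‖ ^ 2 - (1 - s) * ‖(R * Y) u‖ ^ 2 : ℝ) : ℂ) := by push_cast; rfl
        rw [this] at h1
        have h1' : 0 ≤ (s * ‖(star B * Y) u‖ ^ 2 - (1 - s) * ‖(R * Y) u‖ ^ 2 : ℝ) := by
          simpa only [RCLike.re_to_complex, Complex.ofReal_re] using h1
        linarith
      have hq : ‖R * Y‖ ≤ Real.sqrt (s * ‖N'‖ ^ 2 / (1 - s)) * ‖R * Y‖ := by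
        apply ContinuousLinearMap.opNorm_le_bound _ (by positivity)
        intro u
        have e1 := hest u
        rw [← hYN] at e1
        have e2 : ‖(R * Y * N') u‖ ≤ ‖R * Y‖ * ‖N'‖ * ‖u‖ :=
          (ContinuousLinearMap.le_opNorm _ _).trans (by gcongr; exact norm_mul_le _ _)
        have e3 : ‖(R * Y * N') u‖ ^ 2 ≤ (‖R * Y‖ * ‖N'‖ * ‖u‖) ^ 2 := by gcongr
        have h1s : 0 < 1 - s := by linarith
        refine (pow_le_pow_iff_left₀ (norm_nonneg _) (by positivity) two_ne_zero).1 ?_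
        rw [mul_pow, mul_pow, Real.sq_sqrt (by positivity), div_mul_eq_mul_div, div_mul_eq_mul_div,
          le_div_iff₀ h1s]
        nlinarith
      have hq1 : Real.sqrt (s * ‖N'‖ ^ 2 / (1 - s)) < 1 := by
        rw [Real.sqrt_lt' one_pos, div_lt_iff₀ (by linarith)]; linarith
      have : ‖R * Y‖ = 0 := by
        by_contra hne
        have : 0 < ‖R * Y‖ := lt_of_le_of_ne (norm_nonneg _) (Ne.symm hne)
        nlinarith
      exact norm_eq_zero.1 this
    have hRX : R * P2 * X = X := by
      rw [hh, sub_mul, one_mul, sub_eq_zero] at hKX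
      exact hKX.symm
    have cP2 : P2 * R = R * P2 := cR _
    have hF : SemiconjBy X N' (star (B * P2)) := by
      show X * N' = star (B * P2) * X
      rw [star_mul, hP2, sa, ← hP2, mul_assoc P2, ← hXN]
      calc X * N' = (R * P2 * X) * N' := by rw [hRX]
        _ = P2 * (R * X * N') := by rw [← cP2]; noncomm_ring
    have hF2 := hF.star_right (bnormal _) (by have := bnormal (fun t : ℝ => (max t s)⁻¹); infer_instance)
    rw [star_star] at hF2
    have hF3 : X * star N' = B * P2 * X := hF2
    have hBX : B * X = R * X * star N' := by
      calc B * X = B * (R * P2 * X) := by rw [hRX]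
        _ = (B * R) * P2 * X := by noncomm_ring
        _ = R * (B * P2 * X) := by rw [← hRB]; noncomm_ring
        _ = R * X * star N' := by rw [← hF3]; noncomm_ring
    have hX1 : (1 - R) * X = R * X * (N' * star N') := by
      apply hcan
      calc R * ((1 - R) * X) = (star B * B) * X := by rw [hBB]; noncomm_ring
        _ = star B * (B * X) := by noncomm_ring
        _ = star B * R * X * star N' := by rw [hBX]; noncomm_ring
        _ = R * (star B * X) * star N' := by rw [← hRBs]; noncomm_ring
        _ = R * (R * X * (N' * star N')) := by rw [← hXN]; noncomm_ring
    have hNN : G * (N' * star N') * R = G * (1 - R) := by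
      rw [hN', star_mul, hP, sa, ← hP]
      have cP : P * R = R * P := cR _
      have cPBs : P * star B = star B * P := cBs _
      have cG : G * R = R * G := cR _
      have cPB : P * B = B * P := cB _
      have : G * (1 - R) * (R * P) * (R * P) = G * (1 - R) := by
        have a1 : G * (R * P) = G := by
          rw [← mul_assoc, cG, mul_assoc, ← hPG, ← mul_assoc, hRPG]
        have a2 : (1 - R) * (R * P) = (R * P) * (1 - R) := by
          have : R * (R * P) = R * P * R := by rw [mul_assoc, cP]
          rw [sub_mul, mul_sub, one_mul, mul_one, this]
        rw [mul_assoc G, a2, ← mul_assoc G, a1, mul_assoc G, a2, ← mul_assoc G, a1]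
      rw [← this]
      have b1 : B * P * (P * star B) * R = (R - R * R) * (P * P * R) := by
        rw [← hBB', ← cPB]
        calc P * B * (P * star B) * R = P * (B * P) * star B * R := by noncomm_ring
          _ = P * P * (B * star B) * R := by rw [← cPB]; noncomm_ring
          _ = P * P * (R * R - R * R * R) := by rw [hBB']; noncomm_ring
          _ = (P * P * R) * (R - R * R) := by noncomm_ring
          _ = (R - R * R) * (P * P * R) := by
            have c : Commute P R := cP
            have c2 : Commute (P * P * R) (R - R * R) := by
              have : Commute (P * P * R) R := ((c.mul_left c).mul_left (Commute.refl R))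
              exact this.sub_right (this.mul_right this)
            exact c2.eq
          _ = _ := by rw [hBB']
      rw [mul_assoc, b1]
      have b2 : P * P * R = P * (R * P) := by rw [mul_assoc, cP]
      rw [b2]; noncomm_ring
    have : X * (N' * star N') * R = X * (1 - R) := by
      rw [hX]
      calc C * G * (N' * star N') * R = C * (G * (N' * star N') * R) := by noncomm_ring
        _ = _ := by rw [hNN]; noncomm_ring
    -- (1-R) X R = R X (1 - R)
    have e : (1 - R) * X * R = R * (X * (1 - R)) := by
      rw [hX1, ← this]; noncomm_ring
    have e' : X * R - R * X * R = R * X - R * X * R := by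
      have l : (1 - R) * X * R = X * R - R * X * R := by noncomm_ring
      have r : R * (X * (1 - R)) = R * X - R * X * R := by noncomm_ring
      rw [← l, ← r, e]
    exact (sub_left_injective e').symm
  have hRC : R * C = C * R := by
    apply hcan'
    have key : ∀ d : ℝ, 0 < d → ‖R * C * R - C * R * R‖ ≤ (2 * ‖R‖ * ‖C‖) * d := by
      intro d hd
      have hm := main d hd
      set G := cfc (fun t : ℝ => max (t - d) 0) R with hG
      have hn : ‖R - G‖ ≤ d := by
        have : R - G = cfc (fun t : ℝ => t - max (t - d) 0) R := by
          rw [cfc_sub (fun t : ℝ => t) _ R (by fun_prop) (by fun_prop), cfc_id' ℝ R]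
        rw [this]
        apply norm_cfc_le hd.le
        intro t ht
        have := hspec t ht
        rw [Real.norm_eq_abs, abs_le]
        rcases le_total t d with q | q
        · rw [max_eq_right (by linarith)]; constructor <;> linarith
        · rw [max_eq_left (by linarith)]; constructor <;> linarith
      have : R * C * R - C * R * R = R * C * (R - G) - C * (R - G) * R := by
        have : R * C * G = C * G * R := by rw [← hm]; noncomm_ring
        rw [mul_sub, mul_sub, sub_mul, this]; noncomm_ring
      rw [this]
      calc _ ≤ ‖R * C * (R - G)‖ + ‖C * (R - G) * R‖ := norm_sub_le _ _
        _ ≤ ‖R‖ * ‖C‖ * d + ‖C‖ * d * ‖R‖ := by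
          gcongr
          · exact (norm_mul_le _ _).trans (by gcongr; exact norm_mul_le _ _)
          · exact (norm_mul_le _ _).trans (by gcongr; exact (norm_mul_le _ _).trans (by gcongr))
        _ = _ := by ring
    have : ‖R * C * R - C * R * R‖ ≤ 0 := by
      apply le_of_forall_pos_le_add
      intro ε hε
      have := key (ε / (2 * ‖R‖ * ‖C‖ + 1)) (by positivity)
      refine this.trans ?_
      rw [zero_add, mul_div_assoc', div_le_iff₀ (by positivity)]
      nlinarith
    exact sub_eq_zero.1 (norm_le_zero_iff.1 this)
  refine ⟨hRC, ?_⟩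
  have hCB : C * B = star B * C := by
    apply hcan
    rw [← mul_assoc, h, mul_assoc, ← hRC, ← mul_assoc, ← hRBs, mul_assoc]
  have n1 : IsStarNormal B := ⟨by show star B * B = B * star B; rw [hBB, hBB']⟩
  have := (show SemiconjBy C B (star B) from hCB).star_right n1 inferInstance
  rw [star_star] at this
  exact this.eq.symm

theorem FP.clo {H : Type*} [NormedAddCommGroup H] [InnerProductSpace ℂ H] [CompleteSpace H]
    (t : Submodule ℂ (H × H)) (tc : IsClosed (t : Set (H × H)))
    (tf : ∀ x y y', (x, y) ∈ t → (x, y') ∈ t → y = y')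
    (A : H →L[ℂ] H) (hA : ∀ u, ∃ w, (A u, w) ∈ t) :
    ∃ C : H →L[ℂ] H, ∀ u, (A u, C u) ∈ t := by
  choose f hf using hA
  let g : H →ₗ[ℂ] H :=
    { toFun := f
      map_add' := fun a b => tf _ _ _ (hf _) (by
        have := t.add_mem (hf a) (hf b)
        simpa using this)
      map_smul' := fun c a => tf _ _ _ (hf _) (by
        have := t.smul_mem c (hf a)
        simpa using this) }
  refine ⟨ContinuousLinearMap.ofIsClosedGraph (g := g) ?_, fun u => hf u⟩
  have : (g.graph : Set (H × H)) = (fun p : H × H => (A p.1, p.2)) ⁻¹' (t : Set (H × H)) := by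
    ext ⟨a, b⟩
    simp only [SetLike.mem_coe, LinearMap.mem_graph_iff, Set.mem_preimage]
    constructor
    · intro e
      rw [e]; exact hf a
    · intro e
      exact tf _ _ _ e (hf a)
  rw [this]
  exact tc.preimage (by fun_prop)

theorem FP.exRB {H : Type*} [NormedAddCommGroup H] [InnerProductSpace ℂ H] [CompleteSpace H]
    (n m : Submodule ℂ (H × H)) (nc : IsClosed (n : Set (H × H)))
    (hadj : ∀ a b, (∀ x y, (x, y) ∈ n → inner ℂ y a = inner ℂ x b) → (a, b) ∈ m) :
    ∃ R B : H →L[ℂ] H, ∀ u, (R u, B u) ∈ n ∧ (B u, u - R u) ∈ m := by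
  let e := WithLp.prodContinuousLinearEquiv 2 ℂ H H
  let K : Submodule ℂ (WithLp 2 (H × H)) := n.comap e.toLinearMap
  have hK : IsClosed (K : Set (WithLp 2 (H × H))) := nc.preimage e.continuous
  have : CompleteSpace K := hK.completeSpace_coe
  let P : H →L[ℂ] (H × H) := (e : WithLp 2 (H × H) →L[ℂ] H × H) ∘L K.starProjection ∘L
    (e.symm : H × H →L[ℂ] WithLp 2 (H × H)) ∘L (ContinuousLinearMap.inl ℂ H H)
  refine ⟨ContinuousLinearMap.fst ℂ H H ∘L P, ContinuousLinearMap.snd ℂ H H ∘L P, fun u => ?_⟩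
  have h1 : K.starProjection (e.symm (u, 0)) ∈ K := Submodule.starProjection_apply_mem _ _
  refine ⟨h1, hadj _ _ ?_⟩
  intro x y hxy
  have h2 := Submodule.sub_starProjection_mem_orthogonal (K := K) (e.symm (u, 0))
  have h3 := (Submodule.mem_orthogonal _ _).1 h2 (e.symm (x, y)) (by
    show e (e.symm (x, y)) ∈ n
    simpa using hxy)
  rw [WithLp.prod_inner_apply] at h3
  have h4 : inner ℂ x (u - (P u).1) + inner ℂ y (0 - (P u).2) = 0 := h3
  rw [zero_sub, inner_neg_right] at h4
  show inner ℂ y (P u).2 = inner ℂ x (u - (P u).1)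
  linear_combination -h4

theorem FP.dom {H : Type*} [NormedAddCommGroup H] [InnerProductSpace ℂ H] [CompleteSpace H]
    (n m : Submodule ℂ (H × H)) (nc : IsClosed (n : Set (H × H))) (mc : IsClosed (m : Set (H × H)))
    (mf : ∀ x y y', (x, y) ∈ m → (x, y') ∈ m → y = y')
    (hadj : ∀ a b x y, (a, b) ∈ m → (x, y) ∈ n → inner ℂ y a = inner ℂ x b)
    (R B Bs : H →L[ℂ] H) (h1 : ∀ u, (R u, B u) ∈ n) (h2 : ∀ u, (R u, Bs u) ∈ m)
    (h3 : ∀ u, (Bs u, u - R u) ∈ n) (hB : ∀ u, ‖B u‖ = ‖Bs u‖) (x y : H) (hxy : (x, y) ∈ m) :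
    ∃ y', (x, y') ∈ n := by
  let e := WithLp.prodContinuousLinearEquiv 2 ℂ H H
  let L : H →L[ℂ] WithLp 2 (H × H) := (e.symm : H × H →L[ℂ] WithLp 2 (H × H)) ∘L (R.prod Bs)
  let D : Submodule ℂ (WithLp 2 (H × H)) := LinearMap.range L.toLinearMap
  let K := D.topologicalClosure
  have hK : IsClosed (K : Set (WithLp 2 (H × H))) := D.isClosed_topologicalClosure
  have : CompleteSpace K := hK.completeSpace_coe
  let M : Submodule ℂ (WithLp 2 (H × H)) := m.comap e.toLinearMap
  have hM : IsClosed (M : Set (WithLp 2 (H × H))) := mc.preimage e.continuous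
  have hDM : D ≤ M := by
    rintro _ ⟨u, rfl⟩
    exact h2 u
  have hKM : K ≤ M := D.topologicalClosure_minimal hDM hM
  set p := e.symm (x, y) with hp
  have hpM : p ∈ M := hxy
  have hd : K.starProjection p ∈ K := Submodule.starProjection_apply_mem _ _
  have hq := Submodule.sub_starProjection_mem_orthogonal (K := K) p
  set q := p - K.starProjection p with hqdef
  have hqM : q ∈ M := M.sub_mem hpM (hKM hd)
  have hqm : (q.fst, q.snd) ∈ m := hqM
  have hu : ∀ u, inner ℂ u q.fst = 0 := by
    intro u
    have a1 := (Submodule.mem_orthogonal _ _).1 hq (L u) (D.le_topologicalClosure ⟨u, rfl⟩)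
    rw [WithLp.prod_inner_apply] at a1
    have a1' : inner ℂ (R u) q.fst + inner ℂ (Bs u) q.snd = 0 := a1
    have a2 := hadj _ _ _ _ hqm (h3 u)
    rw [inner_sub_left] at a2
    linear_combination a1' + a2
  have q1 : q.fst = 0 := inner_self_eq_zero.1 (hu q.fst)
  have q2 : q.snd = 0 := by
    rw [q1] at hqm
    exact mf _ _ _ hqm m.zero_mem
  have q0 : q = 0 := by
    apply e.injective
    exact Prod.ext q1 q2
  have hpK : p ∈ K := by
    have : p = K.starProjection p := sub_eq_zero.1 q0
    rw [this]; exact hd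
  have hcl : p ∈ closure (D : Set (WithLp 2 (H × H))) := hpK
  obtain ⟨s, hs, hlim⟩ := mem_closure_iff_seq_limit.1 hcl
  choose u hu' using hs
  have hlim2 := (e.continuous.tendsto p).comp hlim
  have e1 : (e ∘ s) = fun k => (R (u k), Bs (u k)) := by
    funext k
    rw [Function.comp, ← hu' k]; rfl
  rw [e1, hp] at hlim2
  have l1 : Filter.Tendsto (fun k => R (u k)) Filter.atTop (nhds x) :=
    (continuous_fst.tendsto _).comp hlim2
  have l2 : Filter.Tendsto (fun k => Bs (u k)) Filter.atTop (nhds y) :=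
    (continuous_snd.tendsto _).comp hlim2
  have hc : CauchySeq (fun k => B (u k)) := by
    have := l2.cauchySeq
    rw [Metric.cauchySeq_iff] at this ⊢
    intro ε hε
    obtain ⟨k, hk⟩ := this ε hε
    refine ⟨k, fun a ha b hb => ?_⟩
    have := hk a ha b hb
    rwa [dist_eq_norm, ← _root_.map_sub, ← hB, _root_.map_sub, ← dist_eq_norm] at this
  obtain ⟨y', hy'⟩ := cauchySeq_tendsto_of_complete hc
  exact ⟨y', nc.mem_of_tendsto (l1.prodMk_nhds hy') (Filter.Eventually.of_forall fun k => h1 _)⟩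

theorem FP.rel {H : Type*} [NormedAddCommGroup H] [InnerProductSpace ℂ H] [CompleteSpace H]
    (t n m : Submodule ℂ (H × H)) (tc : IsClosed (t : Set (H × H)))
    (nc : IsClosed (n : Set (H × H))) (mc : IsClosed (m : Set (H × H)))
    (tf : ∀ x y y', (x, y) ∈ t → (x, y') ∈ t → y = y')
    (nf : ∀ x y y', (x, y) ∈ n → (x, y') ∈ n → y = y')
    (mf : ∀ x y y', (x, y) ∈ m → (x, y') ∈ m → y = y')
    (hadj : ∀ a b, (a, b) ∈ m ↔ ∀ x y, (x, y) ∈ n → inner ℂ y a = inner ℂ x b)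
    (hnorm : ∀ x y z, (x, y) ∈ n → (y, z) ∈ m → ∃ y, (x, y) ∈ m ∧ (y, z) ∈ n)
    (hdom : ∀ x y, (x, y) ∈ n → ∃ w, (x, w) ∈ t)
    (h : ∀ x y z, (x, y) ∈ n → (y, z) ∈ t → ∃ w, (x, w) ∈ t ∧ (w, z) ∈ m) :
    ∀ x y z, (x, y) ∈ m → (y, z) ∈ t → ∃ w, (x, w) ∈ t ∧ (w, z) ∈ n := by
  obtain ⟨R, B, hRB⟩ := FP.exRB n m nc (fun a b => (hadj a b).2)
  have adj : ∀ a b x y, (a, b) ∈ m → (x, y) ∈ n → inner ℂ y a = inner ℂ x b :=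
    fun a b x y h1 h2 => (hadj a b).1 h1 x y h2
  have adj' : ∀ a b x y, (a, b) ∈ m → (x, y) ∈ n → inner ℂ a y = inner ℂ b x :=
    fun a b x y h1 h2 => by rw [← inner_conj_symm, adj a b x y h1 h2, inner_conj_symm]
  set Bs := star B with hBs
  have hBsi : ∀ u v, inner ℂ u (Bs v) = inner ℂ (B u) v := fun u v =>
    ContinuousLinearMap.adjoint_inner_right B u v
  have hm : ∀ u, (R u, Bs u) ∈ m ∧ (Bs u, u - R u) ∈ n := by
    intro u
    obtain ⟨y, hy1, hy2⟩ := hnorm _ _ _ (hRB u).1 (hRB u).2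
    have : y = Bs u := by
      apply ext_inner_left ℂ
      intro v
      rw [hBsi]
      have a1 := adj _ _ _ _ hy1 (hRB v).1
      have a2 := adj' _ _ _ _ (hRB v).2 hy2
      rw [inner_sub_left, inner_sub_right] at a2
      linear_combination -a1 - a2
    rw [← this]; exact ⟨hy1, hy2⟩
  have hRi : ∀ u v, inner ℂ (R u) v = inner ℂ (R u) (R v) + inner ℂ (B u) (B v) := by
    intro u v
    have := adj _ _ _ _ (hRB v).2 (hRB u).1
    rw [inner_sub_right] at this
    linear_combination -this
  have hRsym : ∀ u v, inner ℂ (R u) v = inner ℂ u (R v) := by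
    intro u v
    rw [← inner_conj_symm u, hRi v u, hRi u v]
    simp
  have hR0 : 0 ≤ R := by
    rw [ContinuousLinearMap.nonneg_iff_isPositive]
    refine ⟨fun u v => hRsym u v, fun u => ?_⟩
    rw [ContinuousLinearMap.reApplyInnerSelf_apply, hRi, _root_.map_add]
    exact add_nonneg inner_self_nonneg inner_self_nonneg
  have hRinj : ∀ u, R u = 0 → u = 0 := by
    intro u hu
    have a := hRB u
    rw [hu] at a
    have b : B u = 0 := nf _ _ _ a.1 n.zero_mem
    rw [b, sub_zero] at a
    exact mf _ _ _ a.2 m.zero_mem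
  have hRc : ∀ u v, R u = R v → u = v := fun u v e =>
    sub_eq_zero.1 (hRinj _ (by rw [_root_.map_sub, e, sub_self]))
  have hRn : ∀ x y, (x, y) ∈ n → R y = B x := by
    intro x y hxy
    apply ext_inner_right ℂ
    intro v
    rw [hRsym, adj _ _ _ _ (hm v).1 hxy, hBsi]
  have hRm : ∀ x y, (x, y) ∈ m → R y = Bs x := by
    intro x y hxy
    apply ext_inner_left ℂ
    intro v
    rw [← hRsym, hBsi, adj _ _ _ _ hxy (hRB v).1]
  have e1 : ∀ u, R (B u) = B (R u) := fun u => hRn _ _ (hRB u).1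
  have e1' : ∀ u, R (Bs u) = Bs (R u) := fun u => hRm _ _ (hm u).1
  have e2 : ∀ u, Bs (B u) = R u - R (R u) := fun u => by
    rw [← hRm _ _ (hRB u).2, _root_.map_sub]
  have e3 : ∀ u, B (Bs u) = R u - R (R u) := fun u => by
    rw [← hRn _ _ (hm u).2, _root_.map_sub]
  have hnormB : ∀ u, ‖B u‖ = ‖Bs u‖ := by
    intro u
    have a : inner ℂ (B u) (B u) = inner ℂ (Bs u) (Bs u) := by
      rw [← hBsi, hBsi (Bs u), e2, ← inner_conj_symm _ u, e3]
      rw [inner_conj_symm, inner_sub_left, inner_sub_right, hRsym, hRsym, hRsym]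
    rw [inner_self_eq_norm_sq_to_K, inner_self_eq_norm_sq_to_K] at a
    have a' : ‖B u‖ ^ 2 = ‖Bs u‖ ^ 2 := by exact_mod_cast a
    exact (pow_left_inj₀ (norm_nonneg _) (norm_nonneg _) two_ne_zero).1 a'
  have hdm : ∀ x y, (x, y) ∈ m → ∃ w, (x, w) ∈ t := by
    intro x y hxy
    obtain ⟨y', hy'⟩ := FP.dom n m nc mc mf adj R B Bs (fun u => (hRB u).1) (fun u => (hm u).1)
      (fun u => (hm u).2) hnormB x y hxy
    exact hdom _ _ hy'
  obtain ⟨C, hC⟩ := FP.clo t tc tf R (fun u => hdom _ _ (hRB u).1)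
  obtain ⟨C', hC'⟩ := FP.clo t tc tf Bs (fun u => hdom _ _ (hm u).2)
  have hcore : R * C * B = Bs * C * R := by
    ext u
    show R (C (B u)) = Bs (C (R u))
    have a1 : (B (R u), C (B u)) ∈ t := by rw [← e1]; exact hC _
    obtain ⟨w, hw1, hw2⟩ := h _ _ _ (hRB (R u)).1 a1
    rw [tf _ _ _ hw1 (hC _)] at hw2
    exact hRm _ _ hw2
  obtain ⟨k1, k2⟩ := FP.core R B C hR0
    (fun A hA => by ext u; exact hRinj _ (by simpa using congrArg (fun f => f u) hA))
    (by ext u; exact e1 u) (by ext u; exact e2 u) (by ext u; exact e3 u) hcore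
  have k1' : ∀ u, R (C u) = C (R u) := fun u => congrArg (fun f => f u) k1
  have k2' : ∀ u, B (C u) = C (Bs u) := fun u => congrArg (fun f => f u) k2
  have c1 : ∀ u, C' (R u) = C (Bs u) := fun u =>
    tf _ _ _ (hC' (R u)) (by rw [← e1']; exact hC _)
  have hRst : star R = R := hR0.isSelfAdjoint
  have c2 : R * C' = C' * R := by
    have : (R * C' - C' * R) * R = 0 := by
      ext u
      show R (C' (R u)) - C' (R (R u)) = 0
      rw [c1, c1, k1', e1', sub_self]
    have h5 : R * star (R * C' - C' * R) = 0 := by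
      have := congrArg star this
      rwa [star_mul, hRst, star_zero] at this
    have h6 : star (R * C' - C' * R) = 0 := by
      ext u; exact hRinj _ (by simpa using congrArg (fun f => f u) h5)
    exact sub_eq_zero.1 (star_eq_zero.1 h6)
  have c2' : ∀ u, R (C' u) = C' (R u) := fun u => congrArg (fun f => f u) c2
  have hT : ∀ y z, (y, z) ∈ t → R z = C y := by
    have aux : ∀ y z, (y, z) ∈ t → (C' y, z - C y) ∈ m := by
      intro y z hyz
      have a : (y - R y, z - C y) ∈ t := t.sub_mem hyz (hC y)
      obtain ⟨w, hw1, hw2⟩ := h _ _ _ (hm y).2 a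
      rwa [tf _ _ _ hw1 (hC' _)] at hw2
    intro y z hyz
    have a1 := hRm _ _ (aux y z hyz)
    have a2 := aux _ _ (hC y)
    rw [← c2'] at a2
    have a3 := mf _ _ _ a2 (hm _).1
    rw [← a1, _root_.map_sub, k1'] at a3
    exact (sub_left_injective a3).symm
  intro x y z hxy hyz
  obtain ⟨w, hw⟩ := hdm x y hxy
  refine ⟨w, hw, ?_⟩
  have b1 : B w = R z := by
    apply hRc
    rw [e1, hT _ _ hw, k2', ← hRm _ _ hxy, hT _ _ hyz, k1']
  have b2 : w - R w = Bs z := by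
    have := (hRB w).2
    rw [b1] at this
    exact mf _ _ _ this (hm z).1
  have b3 := n.add_mem (hm z).2 (hRB w).1
  rw [← b2, b1] at b3
  simpa using b3

theorem FP.pcomp_graph {H : Type*} [NormedAddCommGroup H] [InnerProductSpace ℂ H]
    (T S : H →ₗ.[ℂ] H) (x z : H) :
    (x, z) ∈ (T.pcomp S).graph ↔ ∃ y, (x, y) ∈ S.graph ∧ (y, z) ∈ T.graph := by
  have key : ∀ (a : S.domain) (ha : S a ∈ T.domain) (hx : (a : H) ∈ (T.pcomp S).domain),
      (T.pcomp S) ⟨a, hx⟩ = T ⟨S a, ha⟩ := by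
    intro a ha hx
    have : (Submodule.equivMapOfInjective S.domain.subtype S.domain.injective_subtype
      (Submodule.comap S.toFun T.domain)).symm ⟨a, hx⟩ = ⟨a, ha⟩ := by
      rw [LinearEquiv.symm_apply_eq]; rfl
    show T.toFun ((S.toFun.restrict fun _ hx => hx)
      ((Submodule.equivMapOfInjective S.domain.subtype S.domain.injective_subtype
      (Submodule.comap S.toFun T.domain)).symm ⟨a, hx⟩)) = _
    rw [this]; rfl
  constructor
  · intro hx
    rw [LinearPMap.mem_graph_iff] at hx
    obtain ⟨⟨a, ha⟩, h1, h2⟩ := hx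
    obtain ⟨b, hb, rfl⟩ := id ha
    have h1' : (b : H) = x := h1
    have hb' : S b ∈ T.domain := hb
    refine ⟨S b, ?_, ?_⟩
    · rw [← h1']; exact LinearPMap.mem_graph _ _
    · have := key b hb' ha
      have h3 : z = T ⟨S b, hb'⟩ := by rw [← this]; exact h2.symm
      rw [h3]; exact LinearPMap.mem_graph T ⟨S b, hb'⟩
  · rintro ⟨y, h1, h2⟩
    rw [LinearPMap.mem_graph_iff] at h1 h2
    obtain ⟨a, ha1, ha2⟩ := h1
    obtain ⟨b, hb1, hb2⟩ := h2
    simp only at ha1 ha2 hb1 hb2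
    subst ha1 ha2 hb2
    have hm : S a ∈ T.domain := by rw [← hb1]; exact b.2
    have hx : (a : H) ∈ (T.pcomp S).domain := ⟨a, hm, rfl⟩
    have : b = ⟨S a, hm⟩ := Subtype.ext hb1
    rw [this, ← key a hm hx]
    exact LinearPMap.mem_graph _ ⟨(a : H), hx⟩

/-- If `T` is a closed densely defined operator and `N` is an unbounded normal operator with
`dom N ⊆ dom T`, then `T N ⊆ N* T` implies `T N* ⊆ N T`. -/
theorem fuglede_putnam_closed_antinormal (T N : H →ₗ.[ℂ] H)
    (hTc : T.IsClosed) (hTd : Dense (T.domain : Set H)) (hN : N.IsNormalOp)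
    (hdom : N.domain ≤ T.domain)
    (h : T.pcomp N ≤ N.adjoint.pcomp T) :
    T.pcomp N.adjoint ≤ N.pcomp T := by
  have hNd := hN.1
  have fn : ∀ (S : H →ₗ.[ℂ] H) (x y y' : H), (x, y) ∈ S.graph → (x, y') ∈ S.graph → y = y' :=
    fun S x y y' h1 h2 => LinearPMap.mem_graph_snd_inj S h1 h2 rfl
  apply LinearPMap.le_of_le_graph
  rintro ⟨x, z⟩ hxz
  rw [FP.pcomp_graph] at hxz ⊢
  obtain ⟨y, hxy, hyz⟩ := hxz
  refine FP.rel T.graph N.graph N.adjoint.graph hTc hN.2.1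
    (LinearPMap.adjoint_isClosed hNd) (fn T) (fn N) (fn _) ?_ ?_ ?_ ?_ x y z hxy hyz
  · intro a b
    rw [LinearPMap.adjoint_graph_eq_graph_adjoint hNd, Submodule.mem_adjoint_iff]
    simp only [sub_eq_zero]
  · intro x y z h1 h2
    have : (x, z) ∈ (N.adjoint.pcomp N).graph := (FP.pcomp_graph _ _ _ _).2 ⟨y, h1, h2⟩
    rw [hN.2.2] at this
    exact (FP.pcomp_graph _ _ _ _).1 this
  · intro x y h1
    have : x ∈ N.domain := LinearPMap.mem_domain_of_mem_graph h1
    exact ⟨_, LinearPMap.mem_graph T ⟨x, hdom this⟩⟩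
  · intro x y z h1 h2
    have : (x, z) ∈ (T.pcomp N).graph := (FP.pcomp_graph _ _ _ _).2 ⟨y, h1, h2⟩
    exact (FP.pcomp_graph _ _ _ _).1 (LinearPMap.le_graph_of_le h this)
end

section
/- New version of Fuglede's theorem: if T is a closed operator with dom(N) ⊆ dom(T) and N is an unbounded normal operator such that TN ⊆ NT, then TN* ⊆ N*T. -/
open LinearPMap

variable {H : Type*} [NormedAddCommGroup H] [InnerProductSpace ℂ H] [CompleteSpace H]


lemma fc_cutoff {A : Type*} [CStarAlgebra A] (R : A) (hR : IsSelfAdjoint R) (ε : ℝ) (hε : 0 < ε) :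
    ∃ F G : A, ‖F - R‖ ≤ ε ∧ G * R * F = F ∧ IsSelfAdjoint G ∧ 
      (∀ X, Commute R X → Commute F X ∧ Commute G X) := by
  let f : ℝ → ℝ := fun r => r - max (-ε) (min r ε)
  let g : ℝ → ℝ := fun r => r / max (r^2) (ε^2)
  have hf : Continuous f := by fun_prop
  have hpos : ∀ r : ℝ, max (r^2) (ε^2) ≠ 0 := fun r => 
    (lt_of_lt_of_le (by positivity) (le_max_right (r^2) (ε^2))).ne'
  have hg : Continuous g := by
    refine Continuous.div continuous_id (by fun_prop) hpos
  refine ⟨cfc f R, cfc g R, ?_, ?_, ?_, ?_⟩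
  · have e : cfc f R - R = cfc (fun r => f r - id r) R := by
      rw [cfc_sub f id R hf.continuousOn continuousOn_id, cfc_id ℝ R]
    rw [e]
    refine norm_cfc_le hε.le fun r _ => ?_
    simp only [f, id, Real.norm_eq_abs]
    rw [abs_le]
    constructor
    · have : max (-ε) (min r ε) ≤ ε := max_le (by linarith) (min_le_right _ _)
      linarith
    · have : -ε ≤ max (-ε) (min r ε) := le_max_left _ _
      linarith
  · have : cfc g R * R = cfc (fun r => g r * r) R := by
      have e := cfc_mul g id R hg.continuousOn continuousOn_id
      rw [cfc_id ℝ R] at e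
      exact e.symm
    have hgi : Continuous (fun r => g r * r) := hg.mul continuous_id
    rw [this, ← cfc_mul _ f R hgi.continuousOn hf.continuousOn]
    congr 1
    funext r
    by_cases h : |r| ≤ ε
    · have : f r = 0 := by
        rw [abs_le] at h
        simp only [f]; rw [min_eq_left h.2, max_eq_right h.1, sub_self]
      simp [this]
    · have h2 : ε^2 ≤ r^2 := by
        rw [← sq_abs r]; push Not at h; gcongr
      have h3 : r ≠ 0 := by
        rintro rfl
        simp at h
        linarith
      simp only [g]; rw [max_eq_left h2]
      field_simp
  · exact cfc_predicate g R
  · intro X hX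
    exact ⟨hR.commute_cfc hX f, hR.commute_cfc hX g⟩

lemma fc_bounded {A : Type*} [CStarAlgebra A] (R C B : A) (hR : IsSelfAdjoint R)
    (hC : IsStarNormal C) (hRC : Commute R C) (h : C * B * R = R * B * C) :
    R * (star C * B * R - R * B * star C) * R = 0 := by
  have hRC' : Commute R (star C) := by
    have := hRC.star_star; rwa [hR.star_eq] at this
  have key : ∀ ε : ℝ, 0 < ε → ∃ F : A, ‖F - R‖ ≤ ε ∧ 
      F * (star C * B * R - R * B * star C) * F = 0 := by
    intro ε hε
    obtain ⟨F, G, hF, hGF, hG, hc⟩ := fc_cutoff R hR ε hε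
    refine ⟨F, hF, ?_⟩
    have FC := (hc C hRC).1.eq
    have GC := (hc C hRC).2.eq
    have FC' := (hc _ hRC').1.eq
    have GC' := (hc _ hRC').2.eq
    have FR := (hc R (Commute.refl R)).1.eq
    have GR := (hc R (Commute.refl R)).2.eq
    have GF : F * G = G * F := ((hc G (hc R (Commute.refl R)).2.symm).1).eq
    have hFRG : F * R * G = F := by rw [mul_assoc, ← GR, ← mul_assoc, GF, mul_assoc, FR, ← mul_assoc, hGF]
    have hFGR : F * G * R = F := by rw [mul_assoc, GR, ← mul_assoc, hFRG]
    have hRGF : R * G * F = F := by rw [← GR, hGF]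
    have hn : IsStarNormal (C * G) := by
      constructor
      rw [star_mul, hG.star_eq]
      have := hC.star_comm_self.eq
      show G * star C * (C * G) = C * G * (G * star C)
      calc G * star C * (C * G) = G * (star C * C) * G := by noncomm_ring
        _ = (G * C) * (star C * G) := by rw [this]; noncomm_ring
        _ = _ := by rw [GC, ← GC']
    have hcm : Commute (C * G) (F * B * F) := by
      show C * G * (F * B * F) = F * B * F * (C * G)
      calc C * G * (F * B * F) = C * (F * G) * B * F := by rw [GF]; noncomm_ring
        _ = (F * G) * C * B * (R * G * F) := by
          rw [hRGF, mul_assoc F G C, GC, ← mul_assoc F C G, FC]; noncomm_ring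
        _ = (F * G) * (C * B * R) * (G * F) := by noncomm_ring
        _ = (F * G * R) * B * C * (F * G) := by rw [h, GF]; noncomm_ring
        _ = F * B * (C * F) * G := by rw [hFGR]; noncomm_ring
        _ = _ := by rw [← FC]; noncomm_ring
    have h2 := (hn.commute_star_left hcm).eq
    rw [star_mul, hG.star_eq] at h2
    have e1 : R * (G * star C * (F * B * F)) * R = F * (star C * B * R) * F := by
      calc _ = R * G * (star C * F) * B * (F * R) := by noncomm_ring
        _ = (R * G * F) * star C * B * (R * F) := by rw [← FC', FR]; noncomm_ring
        _ = _ := by rw [hRGF]; noncomm_ring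
    have e2 : R * (F * B * F * (G * star C)) * R = F * (R * B * star C) * F := by
      calc _ = (R * F) * B * (F * G) * (star C * R) := by noncomm_ring
        _ = (F * R) * B * (F * G * R) * star C := by rw [← hRC'.eq, FR]; noncomm_ring
        _ = F * R * B * (F * star C) := by rw [hFGR]; noncomm_ring
        _ = _ := by rw [FC']; noncomm_ring
    rw [mul_sub, sub_mul, ← e1, ← e2, h2, sub_self]
  choose! F hF1 hF2 using key
  set X := star C * B * R - R * B * star C
  have ht : Filter.Tendsto F (nhdsWithin 0 (Set.Ioi 0)) (nhds R) := by
    rw [tendsto_iff_norm_sub_tendsto_zero]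
    refine squeeze_zero' (.of_forall fun _ => norm_nonneg _)
      (Filter.eventually_of_mem self_mem_nhdsWithin fun ε hε => hF1 ε hε) ?_
    exact tendsto_nhdsWithin_of_tendsto_nhds Filter.tendsto_id
  have ht2 := (ht.mul_const X).mul ht
  refine tendsto_nhds_unique ht2 (Filter.Tendsto.congr' ?_ tendsto_const_nhds)
  exact Filter.eventually_of_mem self_mem_nhdsWithin fun ε hε => (hF2 ε hε).symm

lemma fc_douglas (C : H →L[ℂ] H) (hC : IsStarNormal C) (u : H) :
    ∃ w, C w = C.adjoint u := by
  have hn : ∀ v, ‖C.adjoint v‖ = ‖C v‖ := fun v => by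
    rw [ContinuousLinearMap.isStarNormal_iff_norm_eq_adjoint] at hC
    exact (hC v).symm
  let L : H →ₗ[ℂ] H := C.adjoint.toLinearMap
  let ψ : H →ₗ[ℂ] ℂ := (innerSL ℂ u).toLinearMap ∘ₗ C.toLinearMap
  have hker : LinearMap.ker L ≤ LinearMap.ker ψ := by
    intro v hv
    have hv : C.adjoint v = 0 := hv
    have : C v = 0 := by rw [← norm_eq_zero, ← hn, hv, norm_zero]
    simp [ψ, this]
  let φ : LinearMap.range L →ₗ[ℂ] ℂ := (Submodule.liftQ _ ψ hker) ∘ₗ L.quotKerEquivRange.symm.toLinearMap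
  have hφ : ∀ v, φ ⟨L v, v, rfl⟩ = inner ℂ u (C v) := by
    intro v
    have : L.quotKerEquivRange.symm ⟨L v, v, rfl⟩ = Submodule.Quotient.mk v := by
      rw [LinearEquiv.symm_apply_eq]; rfl
    simp only [φ, LinearMap.comp_apply, LinearEquiv.coe_coe]
    rw [this]; rfl
  let φc : StrongDual ℂ (LinearMap.range L) := φ.mkContinuous ‖u‖ (by
    rintro ⟨_, v, rfl⟩
    rw [hφ]
    refine (norm_inner_le_norm _ _).trans ?_
    rw [← hn]; rfl)
  obtain ⟨g, hg, -⟩ := exists_extension_norm_eq _ φc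
  refine ⟨(InnerProductSpace.toDual ℂ H).symm g, ?_⟩
  refine ext_inner_right ℂ fun v => ?_
  rw [ContinuousLinearMap.adjoint_inner_left, ← ContinuousLinearMap.adjoint_inner_right,
    InnerProductSpace.toDual_symm_apply, ← hφ]
  exact hg ⟨L v, v, rfl⟩

lemma fc_closedGraph (T : H →ₗ.[ℂ] H) (hT : T.IsClosed) (A : H →L[ℂ] H) (h : ∀ x, A x ∈ T.domain) :
    ∃ B : H →L[ℂ] H, ∀ x, (A x, B x) ∈ T.graph := by
  let g : H →ₗ[ℂ] H := T.toFun ∘ₗ (A.toLinearMap.codRestrict T.domain h)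
  have hg : ∀ x, (A x, g x) ∈ T.graph := fun x => T.mem_graph ⟨A x, h x⟩
  have hcl : IsClosed (g.graph : Set (H × H)) := by
    have : (g.graph : Set (H × H)) = (fun p : H × H => (A p.1, p.2)) ⁻¹' (T.graph : Set (H × H)) := by
      ext ⟨x, y⟩
      simp only [SetLike.mem_coe, LinearMap.mem_graph_iff, Set.mem_preimage]
      constructor
      · rintro rfl; exact hg x
      · intro hy; exact T.mem_graph_snd_inj hy (hg x) rfl
    rw [this]
    exact IsClosed.preimage (by fun_prop) hT
  exact ⟨ContinuousLinearMap.ofIsClosedGraph hcl, hg⟩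

/-- von Neumann -/
lemma fc_vonNeumann (N : H →ₗ.[ℂ] H) (hd : Dense (N.domain : Set H)) (hN : N.IsClosed) :
    ∃ R C : H →L[ℂ] H, (∀ u, (R u, C u) ∈ N.graph) ∧ (∀ u, (C u, u - R u) ∈ N.adjoint.graph) := by
  let e := WithLp.prodContinuousLinearEquiv 2 ℂ H H
  let K : Submodule ℂ (WithLp 2 (H × H)) := N.graph.comap e.toLinearMap
  have hK : IsClosed (K : Set (WithLp 2 (H × H))) := hN.preimage e.continuous
  have : CompleteSpace K := hK.completeSpace_coe
  let P : H →L[ℂ] H × H := e.toContinuousLinearMap ∘L K.starProjection ∘L e.symm.toContinuousLinearMap ∘L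
    ContinuousLinearMap.inl ℂ H H
  have hP : ∀ u, P u ∈ N.graph := fun u => 
    (K.starProjection_apply_mem (e.symm (u, 0)))
  refine ⟨ContinuousLinearMap.fst ℂ H H ∘L P, ContinuousLinearMap.snd ℂ H H ∘L P, hP, fun u => ?_⟩
  rw [LinearPMap.adjoint_graph_eq_graph_adjoint hd, Submodule.mem_adjoint_iff]
  intro a b hab
  have := K.starProjection_inner_eq_zero (e.symm (u, 0)) (e.symm (a,b)) hab
  rw [← inner_conj_symm, map_eq_zero] at this
  rw [WithLp.prod_inner_apply] at this
  have h1 : inner ℂ a (u - (P u).1) + inner ℂ b (0 - (P u).2) = 0 := this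
  rw [zero_sub, inner_neg_right] at h1
  show inner ℂ b (P u).2 - inner ℂ a (u - (P u).1) = 0
  linear_combination -h1

lemma LinearPMap.mem_pcomp_graph (T S : H →ₗ.[ℂ] H) (x z : H) : 
  (x,z) ∈ (T.pcomp S).graph ↔ ∃ y, (x,y) ∈ S.graph ∧ (y,z) ∈ T.graph := by
  have key : ∀ (x : S.domain) (hx : S x ∈ T.domain) (hx' : (x:H) ∈ (T.pcomp S).domain), 
    (T.pcomp S) ⟨x, hx'⟩ = T ⟨S x, hx⟩ := by
    intro x hx hx'
    have : (Submodule.equivMapOfInjective S.domain.subtype S.domain.injective_subtype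
      (Submodule.comap S.toFun T.domain)).symm ⟨x, hx'⟩ = ⟨x, hx⟩ := by
      rw [LinearEquiv.symm_apply_eq]; rfl
    change T.toFun ((S.toFun.restrict fun _ hx => hx) ((Submodule.equivMapOfInjective S.domain.subtype S.domain.injective_subtype
      (Submodule.comap S.toFun T.domain)).symm ⟨x, hx'⟩)) = _
    rw [this]; rfl
  constructor
  · intro h
    rw [LinearPMap.mem_graph_iff] at h
    obtain ⟨⟨_, ⟨x, hx, rfl⟩⟩, rfl, h2⟩ := h
    refine ⟨S x, S.mem_graph x, ?_⟩
    have := key x hx ⟨x, hx, rfl⟩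
    dsimp only at h2
    rw [← h2]
    exact this ▸ T.mem_graph ⟨S x, hx⟩
  · rintro ⟨y, h1, h2⟩
    rw [LinearPMap.mem_graph_iff] at h1 h2
    obtain ⟨x, rfl, h1⟩ := h1
    obtain ⟨y, rfl, h2⟩ := h2
    dsimp only at h1 h2 
    have hx : S x ∈ T.domain := h1 ▸ y.2
    have e : (⟨S x, hx⟩ : T.domain) = y := Subtype.ext h1
    rw [LinearPMap.mem_graph_iff]
    refine ⟨⟨x, ⟨x, hx, rfl⟩⟩, rfl, ?_⟩
    exact (key x hx _).trans (by rw [e]; exact h2)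

lemma fc_adj (N : H →ₗ.[ℂ] H) (hd : Dense (N.domain : Set H)) {a b x y : H}
    (h1 : (a, b) ∈ N.graph) (h2 : (x, y) ∈ N.adjoint.graph) : inner ℂ b x = inner ℂ a y := by
  rw [LinearPMap.adjoint_graph_eq_graph_adjoint hd, Submodule.mem_adjoint_iff] at h2
  exact sub_eq_zero.1 (h2 a b h1)

lemma fc_dom (N : H →ₗ.[ℂ] H) (hd : Dense (N.domain : Set H)) (hc : N.IsClosed)
    (R C : H →L[ℂ] H) (hC : IsStarNormal C) (ha : ∀ u, (R u, C u) ∈ N.graph)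
    (h3 : ∀ u, (R u, C.adjoint u) ∈ N.adjoint.graph)
    (h4 : ∀ u, (C.adjoint u, u - R u) ∈ N.graph)
    (x y : H) (hxy : (x, y) ∈ N.adjoint.graph) : ∃ z, (x, z) ∈ N.graph := by
  let e := WithLp.prodContinuousLinearEquiv 2 ℂ H H
  let L : H →L[ℂ] WithLp 2 (H × H) := e.symm.toContinuousLinearMap ∘L (R.prod C.adjoint)
  let M := (LinearMap.range L.toLinearMap).topologicalClosure
  have hMc : IsClosed (M : Set (WithLp 2 (H × H))) := Submodule.isClosed_topologicalClosure _
  have : CompleteSpace M := hMc.completeSpace_coe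
  have hMG : ∀ p ∈ M, e p ∈ N.adjoint.graph := by
    intro p hp
    have hcl : IsClosed (e ⁻¹' (N.adjoint.graph : Set (H × H))) :=
      (LinearPMap.adjoint_isClosed hd).preimage e.continuous
    refine (closure_minimal ?_ hcl) hp
    rintro _ ⟨u, rfl⟩
    exact h3 u
  have hmem : e.symm (x, y) ∈ M := by
    have hp := M.starProjection_apply_mem (e.symm (x, y))
    have ho := M.sub_starProjection_mem_orthogonal (e.symm (x, y))
    set p := M.starProjection (e.symm (x, y))
    set q := e.symm (x, y) - p with hq
    have hqG : ((e q).1, (e q).2) ∈ N.adjoint.graph := by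
      have := N.adjoint.graph.sub_mem hxy (hMG p hp)
      have e2 : (e q) = (x, y) - e p := by rw [hq, _root_.map_sub]; simp
      rw [← e2] at this
      exact this
    have hq1 : (e q).1 = 0 := by
      refine ext_inner_left ℂ fun u => ?_
      have h5 : inner ℂ (L u) q = 0 :=
        ho _ (Submodule.le_topologicalClosure _ ⟨u, rfl⟩)
      rw [WithLp.prod_inner_apply] at h5
      have h6 : inner ℂ (R u) (e q).1 + inner ℂ (C.adjoint u) (e q).2 = 0 := h5
      have h7 := fc_adj N hd (h4 u) hqG
      rw [← h7, inner_sub_left] at h6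
      rw [inner_zero_right]
      linear_combination h6
    have hq2 : (e q).2 = 0 := N.adjoint.graph_fst_eq_zero_snd hqG hq1
    have : q = 0 := by
      apply e.injective
      rw [_root_.map_zero]
      exact Prod.ext hq1 hq2
    rw [sub_eq_zero.1 (hq.symm.trans this)]
    exact hp
  obtain ⟨s, hs, hlim⟩ := mem_closure_iff_seq_limit.1 hmem
  choose u hu using hs
  have hlim2 : Filter.Tendsto (fun n => (R (u n), C.adjoint (u n))) Filter.atTop (nhds (x, y)) := by
    have := (e.continuous.tendsto _).comp hlim
    rw [e.apply_symm_apply] at this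
    refine this.congr fun n => ?_
    simp only [Function.comp]
    rw [← hu n]
    rfl
  have l1 := (continuous_fst.tendsto _).comp hlim2
  have l2 := (continuous_snd.tendsto _).comp hlim2
  have hcau : CauchySeq (fun n => C (u n)) := by
    have h8 := l2.cauchySeq
    rw [Metric.cauchySeq_iff] at h8 ⊢
    intro ε hε
    obtain ⟨n0, h9⟩ := h8 ε hε
    refine ⟨n0, fun m hm n hn => ?_⟩
    have := h9 m hm n hn
    simp only [Function.comp, dist_eq_norm, ← _root_.map_sub] at this ⊢
    rwa [ContinuousLinearMap.isStarNormal_iff_norm_eq_adjoint.1 hC]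
  obtain ⟨z, hz⟩ := cauchySeq_tendsto_of_complete hcau
  refine ⟨z, ?_⟩
  exact hc.mem_of_tendsto (l1.prodMk_nhds hz) (.of_forall fun n => ha (u n))

lemma fc_resolvent (N : H →ₗ.[ℂ] H) (hN : N.IsNormalOp) :
    ∃ R C : H →L[ℂ] H, (∀ u, (R u, C u) ∈ N.graph) ∧ (∀ u, (C u, u - R u) ∈ N.adjoint.graph) ∧
      (∀ u, (R u, C.adjoint u) ∈ N.adjoint.graph) ∧ (∀ u, (C.adjoint u, u - R u) ∈ N.graph) ∧
      IsSelfAdjoint R ∧ (∀ u, R u = 0 → u = 0) ∧ IsStarNormal C ∧ Commute R C ∧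
      (∀ u, C.adjoint (C u) = R (u - R u)) ∧
      (∀ x y, (x, y) ∈ N.graph → R y = C x) ∧
      (∀ x y, (x, y) ∈ N.adjoint.graph → R y = C.adjoint x) ∧
      (∀ x y, (x, y) ∈ N.adjoint.graph → ∃ z, (x, z) ∈ N.graph) ∧
      (∀ x y, (x, y) ∈ N.graph → x = R x + C.adjoint y) := by
  obtain ⟨hd, hc, hnorm⟩ := hN
  have sw1 : ∀ x y z, (x, y) ∈ N.graph → (y, z) ∈ N.adjoint.graph →
      ∃ y', (x, y') ∈ N.adjoint.graph ∧ (y', z) ∈ N.graph := by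
    intro x y z h1 h2
    rw [← LinearPMap.mem_pcomp_graph, ← hnorm, LinearPMap.mem_pcomp_graph]
    exact ⟨y, h1, h2⟩
  have sw2 : ∀ x y z, (x, y) ∈ N.adjoint.graph → (y, z) ∈ N.graph →
      ∃ y', (x, y') ∈ N.graph ∧ (y', z) ∈ N.adjoint.graph := by
    intro x y z h1 h2
    rw [← LinearPMap.mem_pcomp_graph, hnorm, LinearPMap.mem_pcomp_graph]
    exact ⟨y, h1, h2⟩
  obtain ⟨R, C, ha, hb⟩ := fc_vonNeumann N hd hc
  have U : ∀ x y z, (x, y) ∈ N.graph → (y, z) ∈ N.adjoint.graph → x = R (x + z) := by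
    intro x y z h1 h2
    set u := x + z with hu
    have g1 : (x - R u, y - C u) ∈ N.graph := N.graph.sub_mem h1 (ha u)
    have g2 : (y - C u, z - (u - R u)) ∈ N.adjoint.graph := N.adjoint.graph.sub_mem h2 (hb u)
    have e1 : z - (u - R u) = -(x - R u) := by rw [hu]; abel
    rw [e1] at g2
    have := fc_adj N hd g1 g2
    rw [inner_neg_right] at this
    have h3 := congrArg Complex.re this
    have h4 : (inner ℂ (y - C u) (y - C u)).re = ‖y - C u‖ ^ 2 := inner_self_eq_norm_sq (𝕜 := ℂ) _
    have h5 : (inner ℂ (x - R u) (x - R u)).re = ‖x - R u‖ ^ 2 := inner_self_eq_norm_sq (𝕜 := ℂ) _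
    rw [Complex.neg_re, h4, h5] at h3
    have h6 : ‖x - R u‖ ^ 2 = 0 := by nlinarith [sq_nonneg ‖y - C u‖, sq_nonneg ‖x - R u‖]
    exact sub_eq_zero.1 (norm_eq_zero.1 (pow_eq_zero_iff (two_ne_zero) |>.1 h6))
  have hsym : ∀ u v, inner ℂ (R u) v = inner ℂ u (R v) := by
    have h1 : ∀ u v, inner ℂ (R u) v = inner ℂ (R u) (R v) + inner ℂ (C u) (C v) := by
      intro u v
      rw [fc_adj N hd (ha u) (hb v), ← inner_add_right]
      congr 1; abel
    intro u v
    rw [h1 u v, ← inner_conj_symm u (R v), h1 v u]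
    simp
  have hsa : IsSelfAdjoint R := by
    rw [ContinuousLinearMap.isSelfAdjoint_iff_isSymmetric]
    exact hsym
  have hj : ∀ x y, (x, y) ∈ N.graph → R y = C x := by
    intro x y h1
    have g1 : (x - R x, y - C x) ∈ N.graph := N.graph.sub_mem h1 (ha x)
    obtain ⟨q, q1, q2⟩ := sw2 _ _ _ (hb x) g1
    have := U _ _ _ q1 q2
    rw [this]; congr 1; abel
  have hC' : ∀ u, (R u, C.adjoint u) ∈ N.adjoint.graph ∧ (C.adjoint u, u - R u) ∈ N.graph := by
    intro u
    obtain ⟨q, q1, q2⟩ := sw1 _ _ _ (ha u) (hb u)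
    have : q = C.adjoint u := by
      refine hd.eq_of_inner_right ℂ fun w hw => ?_
      obtain ⟨w', hw'⟩ := LinearPMap.mem_domain_iff.1 hw
      rw [← fc_adj N hd hw' q1, ← hsym, hj _ _ hw', ContinuousLinearMap.adjoint_inner_right]
    rw [← this]
    exact ⟨q1, q2⟩
  have h3 := fun u => (hC' u).1
  have h4 := fun u => (hC' u).2
  have hk : ∀ x y, (x, y) ∈ N.adjoint.graph → R y = C.adjoint x := by
    intro x y h1
    have g1 : (x - R x, y - C.adjoint x) ∈ N.adjoint.graph := N.adjoint.graph.sub_mem h1 (h3 x)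
    have := U _ _ _ (h4 x) g1
    rw [this]; congr 1; abel
  have hi : ∀ u, C.adjoint (C u) = R (u - R u) := fun u => (hk _ _ (hb u)).symm
  have hCn : IsStarNormal C := by
    constructor
    ext u
    exact (hi u).trans (hj _ _ (h4 u))
  refine ⟨R, C, ha, hb, h3, h4, hsa, ?_, hCn, ?_, hi, hj, hk,
    fc_dom N hd hc R C hCn ha h3 h4, ?_⟩
  · intro u hu
    have h5 : C u = 0 := N.graph_fst_eq_zero_snd (ha u) hu
    have h6 := N.adjoint.graph_fst_eq_zero_snd (hb u) h5
    rwa [hu, sub_zero] at h6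
  · ext u
    exact hj _ _ (ha u)
  · intro x y hxy
    refine ext_inner_right ℂ fun w => ?_
    rw [inner_add_left, ContinuousLinearMap.adjoint_inner_left, fc_adj N hd hxy (hb w), hsym,
      ← inner_add_right]
    congr 1; abel

lemma fc_commute (R C B : H →L[ℂ] H) (hR : IsSelfAdjoint R) (hinj : ∀ u, R u = 0 → u = 0)
    (hC : IsStarNormal C) (hRC : Commute R C) (hi : star C * C = R * (1 - R))
    (h : C * B * R = R * B * C) :
    B * R = R * B ∧ B * star C = star C * B ∧ ∀ X Y : H →L[ℂ] H, X * R = Y * R → X = Y := by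
  have l0 : ∀ X : H →L[ℂ] H, R * X = 0 → X = 0 := by
    intro X hX
    ext u
    exact hinj _ (congrArg (fun Z : H →L[ℂ] H => Z u) hX)
  have r0 : ∀ X : H →L[ℂ] H, X * R = 0 → X = 0 := by
    intro X hX
    have := congrArg star hX
    rw [star_mul, hR.star_eq, star_zero] at this
    exact star_eq_zero.1 (l0 _ this)
  have lc : ∀ X Y : H →L[ℂ] H, R * X = R * Y → X = Y := fun X Y hXY =>
    sub_eq_zero.1 (l0 _ (by rw [mul_sub, hXY, sub_self]))
  have rc : ∀ X Y : H →L[ℂ] H, X * R = Y * R → X = Y := fun X Y hXY =>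
    sub_eq_zero.1 (r0 _ (by rw [sub_mul, hXY, sub_self]))
  have hRC' : R * star C = star C * R := by
    have := hRC.star_star; rw [hR.star_eq] at this; exact this.eq
  have hRCe := hRC.eq
  have h' : star C * B * R = R * B * star C :=
    sub_eq_zero.1 (l0 _ (r0 _ (fc_bounded R C B hR hC hRC h)))
  have e1 : star C * C * B * R * R = R * R * B * (star C * C) := by
    calc star C * C * B * R * R = star C * (C * B * R) * R := by noncomm_ring
      _ = (star C * R) * B * (C * R) := by rw [h]; noncomm_ring
      _ = R * (star C * B * R) * C := by rw [← hRC', ← hRCe]; noncomm_ring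
      _ = _ := by rw [h']; noncomm_ring
  rw [hi] at e1
  have e2 : R * (B * R) * R = R * (R * B) * R := by
    have e3 : R * B * R * R - R * R * B * R * R = R * R * B * R - R * R * B * R * R := by
      calc _ = R * (1 - R) * B * R * R := by noncomm_ring
        _ = _ := by rw [e1]; noncomm_ring
    have := sub_left_injective e3
    calc _ = R * B * R * R := by noncomm_ring
      _ = _ := by rw [this]; noncomm_ring
  have e4 : B * R = R * B := lc _ _ (rc _ _ e2)
  refine ⟨e4, ?_, rc⟩
  apply lc
  apply rc
  calc R * (B * star C) * R = (R * B * star C) * R := by noncomm_ring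
    _ = star C * (B * R) * R := by rw [← h']; noncomm_ring
    _ = (star C * R) * B * R := by rw [e4]; noncomm_ring
    _ = _ := by rw [← hRC']; noncomm_ring

/-- **New version of Fuglede's theorem.** If `T` is a closed operator with `dom N ⊆ dom T`
and `N` is an unbounded normal operator such that `T N ⊆ N T`, then `T N* ⊆ N* T`. -/
theorem fuglede_closed (T N : H →ₗ.[ℂ] H)
    (hTc : T.IsClosed) (hTd : Dense (T.domain : Set H)) (hN : N.IsNormalOp)
    (hdom : N.domain ≤ T.domain)
    (h : T.pcomp N ≤ N.pcomp T) :
    T.pcomp N.adjoint ≤ N.adjoint.pcomp T := by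
  obtain ⟨R, C, ha, hb, h3, h4, hsa, hinj, hCn, hRC, hi, hj, hk, hl, hm⟩ := fc_resolvent N hN
  -- the hypothesis and the goal in terms of graphs
  have hTN : ∀ x y z, (x, y) ∈ N.graph → (y, z) ∈ T.graph →
      ∃ w, (x, w) ∈ T.graph ∧ (w, z) ∈ N.graph := by
    intro x y z h1 h2
    rw [← LinearPMap.mem_pcomp_graph]
    apply LinearPMap.le_graph_of_le h
    rw [LinearPMap.mem_pcomp_graph]
    exact ⟨y, h1, h2⟩
  have hNT : ∀ x y, (x, y) ∈ N.graph → x ∈ T.domain := fun x y hxy =>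
    hdom (LinearPMap.mem_domain_of_mem_graph hxy)
  obtain ⟨B, hB⟩ := fc_closedGraph T hTc R fun u => hNT _ _ (ha u)
  obtain ⟨D, hD⟩ := fc_closedGraph T hTc C.adjoint fun u => hNT _ _ (h4 u)
  obtain ⟨E, hE⟩ := fc_closedGraph T hTc C fun u => by
    obtain ⟨z, hz⟩ := hl _ _ (hb u)
    exact hNT _ _ hz
  have hBE : ∀ u, (B u, E u) ∈ N.graph := by
    intro u
    obtain ⟨w, hw1, hw2⟩ := hTN _ _ _ (ha u) (hE u)
    rwa [T.mem_graph_snd_inj hw1 (hB u) rfl] at hw2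
  have hCBR : C * B * R = R * B * C := by
    ext u
    show C (B (R u)) = R (B (C u))
    rw [← hj _ _ (hBE (R u))]
    congr 1
    refine T.mem_graph_snd_inj (hE (R u)) (hB (C u)) ?_
    exact (congrArg (fun Z : H →L[ℂ] H => Z u) hRC.eq).symm
  have hi' : star C * C = R * (1 - R) := by
    ext u
    exact hi u
  obtain ⟨hBR, hBC, hrc⟩ := fc_commute R C B hsa hinj hCn hRC hi' hCBR
  have hRC' : R * star C = star C * R := by
    have := hRC.star_star; rw [hsa.star_eq] at this; exact this.eq
  have hRD : R * D = B * star C := by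
    apply hrc
    have e1 : D * R = B * star C := by
      ext u
      exact T.mem_graph_snd_inj (hD (R u)) (hB (star C u))
        (congrArg (fun Z : H →L[ℂ] H => Z u) hRC').symm
    calc R * D * R = R * (D * R) := mul_assoc _ _ _
      _ = R * B * star C := by rw [e1, mul_assoc]
      _ = _ := by rw [← hBR, mul_assoc, hRC', mul_assoc]
  have aBR : ∀ u, B (R u) = R (B u) := fun u => congrArg (fun Z : H →L[ℂ] H => Z u) hBR
  have aBC : ∀ u, B (C.adjoint u) = C.adjoint (B u) :=
    fun u => congrArg (fun Z : H →L[ℂ] H => Z u) hBC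
  have aRC : ∀ u, R (C.adjoint u) = C.adjoint (R u) :=
    fun u => congrArg (fun Z : H →L[ℂ] H => Z u) hRC'
  have aRD : ∀ u, R (D u) = B (C.adjoint u) := fun u => congrArg (fun Z : H →L[ℂ] H => Z u) hRD
  -- on the domain of `N`, `R T ⊆ T R`
  have h9 : ∀ x y v, (x, y) ∈ N.graph → (x, v) ∈ T.graph → R v = B x := by
    intro x y v hxy hxv
    have e := hm x y hxy
    have g : (R x + C.adjoint y, B x + D y) ∈ T.graph := T.graph.add_mem (hB x) (hD y)
    have e2 : v = B x + D y := T.mem_graph_snd_inj hxv g e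
    rw [e2, _root_.map_add, aRD, ← aBR, ← _root_.map_add, ← e]
  -- on the range of `N`
  have h10 : ∀ x y v, (x, y) ∈ N.graph → (y, v) ∈ T.graph → R v = B y := by
    intro x y v hxy hyv
    obtain ⟨w, hw1, hw2⟩ := hTN _ _ _ hxy hyv
    have e1 := hj _ _ hw2
    have g1 := ha w
    rw [h9 _ _ _ hxy hw1] at g1
    have e2 : C w = E x := N.mem_graph_snd_inj g1 (hBE x) rfl
    rw [e1, e2]
    exact T.mem_graph_snd_inj (hE x) (hB y) (hj _ _ hxy).symm
  apply LinearPMap.le_of_le_graph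
  rintro ⟨x, v⟩ hxv
  rw [LinearPMap.mem_pcomp_graph] at hxv ⊢
  obtain ⟨y, hxy, hyv⟩ := hxv
  obtain ⟨z, hxz⟩ := hl _ _ hxy
  obtain ⟨w, hw⟩ := LinearPMap.mem_domain_iff.1 (hNT _ _ hxz)
  refine ⟨w, hw, ?_⟩
  -- `y` is in the range of `N`
  obtain ⟨x', hx'⟩ : ∃ x', (x', y) ∈ N.graph := by
    obtain ⟨p, hp⟩ := fc_douglas C hCn x
    have g1 : (x - R x, y - C.adjoint x) ∈ N.adjoint.graph :=
      N.adjoint.graph.sub_mem hxy (h3 x)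
    have g2 : (C.adjoint x, y - C.adjoint x) ∈ (N.adjoint.pcomp N).graph := by
      rw [LinearPMap.mem_pcomp_graph]
      exact ⟨_, h4 x, g1⟩
    rw [hN.2.2, LinearPMap.mem_pcomp_graph] at g2
    obtain ⟨q, -, hq⟩ := g2
    have g3 := N.graph.add_mem (ha p) hq
    refine ⟨R p + q, ?_⟩
    have e : y = C p + (y - C.adjoint x) := by rw [hp]; abel
    rw [e]
    exact g3
  have hRv : R v = B y := h10 _ _ _ hx' hyv
  have hRw : R w = B x := h9 _ _ _ hxz hw
  have hCw : C.adjoint w = R v := by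
    rw [hRv]
    refine sub_eq_zero.1 (hinj _ ?_)
    rw [_root_.map_sub, aRC, hRw, ← aBC, ← hk _ _ hxy, aBR, sub_self]
  have g1 := h4 w
  rw [hCw] at g1
  have e1 : w - R w = C v := N.mem_graph_snd_inj g1 (ha v) rfl
  have g2 := N.adjoint.graph.add_mem (h3 w) (hb v)
  rw [hCw, ← e1] at g2
  have e2 : (w, v) = (R w, R v) + (w - R w, v - R v) := by
    ext <;> simp
  rw [e2]
  exact g2
end
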